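/- arXiv:2006.08308 — 6 statements merged into one kernel-verified Lean document; each statement's English description precedes it below -/
import Mathlib

section
/- Let D ⊆ ℂ be a domain and 𝓕 a family of holomorphic functions on D. If J(𝓕) ≠ ∅, then the exceptional set E(𝓕) contains at most one point. -/
open Filter Topology

/-- A sequence of complex functions tends to `∞` locally uniformly on `U`:
on every compact subset of `U` the moduli eventually exceed any bound,
uniformly. -/
def TendstoInftyLocallyUniformlyOn (F : ℕ → ℂ → ℂ) (U : Set ℂ) : Prop :=
  ∀ M : ℝ, ∀ K ⊆ U, IsCompact K → ∀ᶠ n in atTop, ∀ z ∈ K, M ≤ ‖F n z‖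

/-- The family `𝓕` is normal at the point `z₀` of the domain `D`: there is a
neighborhood `U ⊆ D` of `z₀` on which every sequence in `𝓕` has a subsequence
converging locally uniformly either to a holomorphic function or to `∞`. -/
def IsNormalAt (𝓕 : Set (ℂ → ℂ)) (D : Set ℂ) (z₀ : ℂ) : Prop :=
  ∃ U : Set ℂ, IsOpen U ∧ z₀ ∈ U ∧ U ⊆ D ∧
    ∀ f : ℕ → ℂ → ℂ, (∀ n, f n ∈ 𝓕) →
      ∃ φ : ℕ → ℕ, StrictMono φ ∧
        ((∃ g : ℂ → ℂ, DifferentiableOn ℂ g U ∧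
            TendstoLocallyUniformlyOn (fun n => f (φ n)) g atTop U) ∨
          TendstoInftyLocallyUniformlyOn (fun n => f (φ n)) U)

/-- The Fatou like set of the family `𝓕` on the domain `D`. -/
def fatouLike (𝓕 : Set (ℂ → ℂ)) (D : Set ℂ) : Set ℂ :=
  {z ∈ D | IsNormalAt 𝓕 D z}

/-- The Julia like set of the family `𝓕` on the domain `D`. -/
def juliaLike (𝓕 : Set (ℂ → ℂ)) (D : Set ℂ) : Set ℂ :=
  D \ fatouLike 𝓕 D

/-- The backward orbit of `z` under the family `𝓕` acting on the domain `D`. -/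
def backwardOrbit (𝓕 : Set (ℂ → ℂ)) (D : Set ℂ) (z : ℂ) : Set ℂ :=
  {w ∈ D | ∃ f ∈ 𝓕, f w = z}

/-- The exceptional set of the family `𝓕`: points with finite backward orbit. -/
def exceptionalSet (𝓕 : Set (ℂ → ℂ)) (D : Set ℂ) : Set ℂ :=
  {z : ℂ | (backwardOrbit 𝓕 D z).Finite}

open Metric Set

theorem exists_ball_subset_image_of_deriv_ne_zero {g : ℂ → ℂ} {c : ℂ} {R : ℝ} (hR : 0 < R)
    (hg : DifferentiableOn ℂ g (ball c R)) (hc : deriv g c ≠ 0) :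
    ∃ w, ball w (R * ‖deriv g c‖ / 96) ⊆ g '' ball c R := by
  have hd : DifferentiableOn ℂ (deriv g) (ball c R) := hg.deriv isOpen_ball
  have hsub : closedBall c (R / 2) ⊆ ball c R := closedBall_subset_ball (by linarith)
  obtain ⟨p, hp, hmax⟩ := (isCompact_closedBall c (R / 2)).exists_isMaxOn
    (f := fun z => ‖deriv g z‖ * (R / 2 - dist z c)) ⟨c, mem_closedBall_self (by linarith)⟩
    ((hd.continuousOn.mono hsub).norm.mul (by fun_prop))
  have hcp := hmax (mem_closedBall_self (by linarith : 0 ≤ R / 2))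
  simp only [mem_ofPred_eq, dist_self, sub_zero] at hcp
  have hc' : 0 < ‖deriv g c‖ := norm_pos_iff.2 hc
  obtain ⟨t, ht⟩ : ∃ t, t = (R / 2 - dist p c) / 2 := ⟨_, rfl⟩
  obtain ⟨M, hM⟩ : ∃ M, M = ‖deriv g p‖ := ⟨_, rfl⟩
  rw [← hM, show R / 2 - dist p c = 2 * t by linarith] at hcp
  have hM0 : 0 ≤ M := hM ▸ norm_nonneg _
  have hp' : dist p c ≤ R / 2 := hp
  have hMt : 0 < M * (2 * t) := lt_of_lt_of_le (by positivity) hcp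
  have ht0 : 0 < t := by
    rcases (show 0 ≤ t by linarith).eq_or_lt with h | h
    · simp [← h] at hMt
    · exact h
  have hM1 : 0 < M := by
    rcases hM0.eq_or_lt with h | h
    · simp [← h] at hMt
    · exact h
  have hball : ball p t ⊆ closedBall c (R / 2) := fun z hz => by
    have h1 := dist_triangle z p c
    have h2 := mem_ball.1 hz
    rw [mem_closedBall]; linarith
  have hbound : ∀ z ∈ ball p t, ‖deriv g z‖ ≤ 2 * M := fun z hz => by
    have h1 := hmax (hball hz)
    simp only [mem_ofPred_eq] at h1
    rw [← hM, show R / 2 - dist p c = 2 * t by linarith] at h1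
    have h2 := dist_triangle z p c
    have h3 := mem_ball.1 hz
    have h4 : ‖deriv g z‖ * t ≤ ‖deriv g z‖ * (R / 2 - dist z c) := by
      gcongr; linarith
    nlinarith
  have hmaps : MapsTo (deriv g) (ball p t) (closedBall (deriv g p) (3 * M)) := fun z hz => by
    rw [mem_closedBall, dist_eq_norm]
    have := norm_sub_le (deriv g z) (deriv g p)
    have := hbound z hz
    linarith
  have hsubR : ball p t ⊆ ball c R := hball.trans hsub
  have hsub6 : closedBall p (t / 6) ⊆ ball p t := closedBall_subset_ball (by linarith)
  have hlip : ∀ z ∈ closedBall p (t / 6), ‖deriv g z - deriv g p‖ ≤ M / 2 := fun z hz => by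
    have := Complex.dist_le_div_mul_dist_of_mapsTo_ball (hd.mono hsubR) hmaps (hsub6 hz)
    rw [dist_eq_norm] at this
    refine this.trans ?_
    calc 3 * M / t * dist z p ≤ 3 * M / t * (t / 6) := by gcongr; exact hz
      _ = M / 2 := by field_simp; norm_num
  have hgz : ∀ z ∈ ball p t, DifferentiableAt ℂ g z := fun z hz =>
    hg.differentiableAt (isOpen_ball.mem_nhds (hsubR hz))
  have hmean : ∀ z ∈ closedBall p (t / 6),
      ‖(g z - deriv g p * z) - (g p - deriv g p * p)‖ ≤ M / 2 * ‖z - p‖ := fun z hz => by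
    refine Convex.norm_image_sub_le_of_norm_hasDerivWithin_le (s := closedBall p (t / 6))
      (f := fun z => g z - deriv g p * z) (f' := fun z => deriv g z - deriv g p)
      (fun x hx => ?_) hlip (convex_closedBall _ _) (mem_closedBall_self (by linarith)) hz
    have := (hgz x (hsub6 hx)).hasDerivAt.fun_sub ((hasDerivAt_id' x).const_mul (deriv g p))
    simpa using this.hasDerivWithinAt
  have hsphere : ∀ z ∈ sphere p (t / 6), M * t / 12 ≤ ‖g z - g p‖ := fun z hz => by
    have h1 := hmean z (sphere_subset_closedBall hz)
    have h2 : ‖z - p‖ = t / 6 := by rw [← dist_eq_norm]; exact hz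
    have h3 : ‖deriv g p * (z - p)‖ = M * (t / 6) := by rw [norm_mul, h2, hM]
    have h4 := norm_sub_le (g z - g p) ((g z - deriv g p * z) - (g p - deriv g p * p))
    rw [show (g z - g p) - ((g z - deriv g p * z) - (g p - deriv g p * p))
      = deriv g p * (z - p) by ring, h3] at h4
    rw [h2] at h1
    linarith
  have hne : ∃ᶠ z in 𝓝 p, g z ≠ g p := by
    have h0 : deriv g p ≠ 0 := norm_pos_iff.1 (hM ▸ hM1)
    have := (hgz p (mem_ball_self ht0)).hasDerivAt.eventually_ne (c := g p) h0
    exact this.frequently.filter_mono nhdsWithin_le_nhds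
  have hdc : DiffContOnCl ℂ g (ball p (t / 6)) := by
    refine DifferentiableOn.diffContOnCl ?_
    rw [closure_ball _ (by linarith)]
    exact hg.mono (hsub6.trans hsubR)
  refine ⟨g p, ?_⟩
  have h := hdc.ball_subset_image_closedBall (by linarith) hsphere hne
  refine (ball_subset_ball ?_).trans (h.trans (image_mono (hsub6.trans hsubR)))
  linarith

theorem exists_exp_eq_on_ball {f : ℂ → ℂ} {c : ℂ} {R : ℝ} (hR : 0 < R)
    (hf : DifferentiableOn ℂ f (ball c R)) (h0 : ∀ z ∈ ball c R, f z ≠ 0) :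
    ∃ L : ℂ → ℂ, DifferentiableOn ℂ L (ball c R) ∧ ∀ z ∈ ball c R, f z = Complex.exp (L z) := by
  obtain ⟨P, hP⟩ := ((hf.deriv isOpen_ball).div hf h0).isExactOn_ball
  have hfd : ∀ z ∈ ball c R, HasDerivAt f (deriv f z) z := fun z hz =>
    (hf.differentiableAt (isOpen_ball.mem_nhds hz)).hasDerivAt
  have hcR : c ∈ ball c R := mem_ball_self hR
  have hder : ∀ z ∈ ball c R, HasDerivAt (fun z => f z * Complex.exp (-P z)) 0 z := fun z hz => by
    refine ((hfd z hz).fun_mul (hP z hz).fun_neg.cexp).congr_deriv ?_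
    have := h0 z hz
    rw [Pi.div_apply]
    field_simp
    ring
  have hconst : ∀ z ∈ ball c R, f z * Complex.exp (-P z) = f c * Complex.exp (-P c) := fun z hz =>
    isOpen_ball.is_const_of_deriv_eq_zero (convex_ball c R).isPreconnected
      (fun x hx => (hder x hx).differentiableAt.differentiableWithinAt)
      (fun x hx => (hder x hx).deriv) hz hcR
  refine ⟨fun z => P z + (Complex.log (f c) - P c), fun z hz =>
    ((hP z hz).differentiableAt.add_const _).differentiableWithinAt, fun z hz => ?_⟩
  rw [Complex.exp_add, Complex.exp_sub, Complex.exp_log (h0 c hcR)]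
  have := hconst z hz
  rw [Complex.exp_neg, Complex.exp_neg] at this
  have e1 := Complex.exp_ne_zero (P z)
  have e2 := Complex.exp_ne_zero (P c)
  field_simp at this ⊢
  linear_combination this

theorem abs_im_le_norm_cos (w : ℂ) : |w.im| ≤ ‖Complex.cos w‖ := by
  have h1 : ‖Complex.exp (w * Complex.I)‖ = Real.exp (-w.im) := by simp [Complex.norm_exp]
  have h2 : ‖Complex.exp (-w * Complex.I)‖ = Real.exp (w.im) := by simp [Complex.norm_exp]
  have h3 : ‖Complex.cos w‖ = ‖Complex.exp (w * Complex.I) + Complex.exp (-w * Complex.I)‖ / 2 := by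
    rw [Complex.cos, norm_div]; simp
  have h4 : |Real.sinh w.im| ≤ ‖Complex.cos w‖ := by
    have := abs_norm_sub_norm_le (Complex.exp (-w * Complex.I)) (-Complex.exp (w * Complex.I))
    rw [norm_neg, h1, h2, sub_neg_eq_add, add_comm (Complex.exp _)] at this
    rw [h3, Real.sinh_eq, abs_div, abs_two]
    linarith
  refine le_trans ?_ h4
  rw [Real.abs_sinh]
  exact Real.self_le_sinh_iff.2 (abs_nonneg _)

theorem exists_cos_pi_mul_eq_on_ball {f : ℂ → ℂ} {c : ℂ} {R : ℝ} (hR : 0 < R)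
    (hf : DifferentiableOn ℂ f (ball c R)) (h1 : ∀ z ∈ ball c R, f z ≠ 1)
    (h2 : ∀ z ∈ ball c R, f z ≠ -1) :
    ∃ F : ℂ → ℂ, DifferentiableOn ℂ F (ball c R) ∧ ‖F c‖ ≤ 1 + ‖f c‖ ∧
      ∀ z ∈ ball c R, f z = Complex.cos (Real.pi * F z) := by
  have hpi : (Real.pi : ℂ) ≠ 0 := by exact_mod_cast Real.pi_ne_zero
  have hcR : c ∈ ball c R := mem_ball_self hR
  obtain ⟨L, hL, hLe⟩ := exists_exp_eq_on_ball hR (f := fun z => 1 - f z ^ 2)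
    ((hf.pow 2).const_sub 1) (fun z hz h => by
      have : (1 - f z) * (1 + f z) = 0 := by linear_combination h
      rcases mul_eq_zero.1 this with h | h
      · exact h1 z hz (by linear_combination -h)
      · exact h2 z hz (by linear_combination h))
  have hq : ∀ z ∈ ball c R, Complex.exp (L z / 2) ^ 2 = 1 - f z ^ 2 := fun z hz => by
    rw [hLe z hz, ← Complex.exp_nat_mul]; congr 1; push_cast; ring
  have hprod : ∀ z ∈ ball c R, (f z + Complex.I * Complex.exp (L z / 2)) *
      (f z - Complex.I * Complex.exp (L z / 2)) = 1 := fun z hz => by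
    linear_combination hq z hz - Complex.exp (L z / 2) ^ 2 * Complex.I_sq
  obtain ⟨K, hK, hKe⟩ := exists_exp_eq_on_ball hR
    (f := fun z => f z + Complex.I * Complex.exp (L z / 2))
    (hf.add ((hL.div_const 2).cexp.const_mul _)) (fun z hz h => by
      have := hprod z hz
      rw [h, zero_mul] at this
      exact zero_ne_one this)
  have hcos : ∀ z ∈ ball c R, ∀ n : ℤ,
      f z = Complex.cos (Real.pi * (K z / (Complex.I * Real.pi) + n * 2)) := fun z hz n => by
    have e1 : (Real.pi : ℂ) * (K z / (Complex.I * Real.pi) + n * 2)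
        = -(K z * Complex.I) + n * (2 * Real.pi) := by
      have := Complex.I_ne_zero
      field_simp
      linear_combination (K z) * Complex.I_sq
    rw [e1, Complex.cos_add_int_mul_two_pi, Complex.cos]
    have e2 : -(K z * Complex.I) * Complex.I = K z := by
      linear_combination (-K z) * Complex.I_sq
    have e3 : -(-(K z * Complex.I)) * Complex.I = -K z := by
      linear_combination (K z) * Complex.I_sq
    rw [e2, e3]
    have e4 : Complex.exp (-K z) = f z - Complex.I * Complex.exp (L z / 2) := by
      rw [Complex.exp_neg, ← hKe z hz]
      exact inv_eq_of_mul_eq_one_right (hprod z hz)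
    rw [e4, ← hKe z hz]
    ring
  obtain ⟨n, hn⟩ : ∃ n : ℤ, |(K c / (Complex.I * Real.pi)).re + n * 2| ≤ 1 := by
    refine ⟨-round ((K c / (Complex.I * Real.pi)).re / 2), ?_⟩
    have := abs_sub_round ((K c / (Complex.I * Real.pi)).re / 2)
    push_cast
    rw [abs_le] at this ⊢
    constructor <;> linarith
  refine ⟨fun z => K z / (Complex.I * Real.pi) + n * 2, (hK.div_const _).add_const _, ?_,
    fun z hz => hcos z hz n⟩
  refine (Complex.norm_le_abs_re_add_abs_im _).trans (add_le_add (by simpa using hn) ?_)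
  rw [hcos c hcR n]
  refine le_trans ?_ (abs_im_le_norm_cos _)
  rw [Complex.im_ofReal_mul, abs_mul, abs_of_pos Real.pi_pos]
  have := Real.pi_gt_three
  nlinarith [abs_nonneg ((K c / (Complex.I * Real.pi) + n * 2)).im]

theorem exists_cosh_pi_mul_eq_natCast (t : ℝ) :
    ∃ y : ℝ, |y - t| ≤ 1 ∧ ∃ n : ℕ, Real.cosh (Real.pi * y) = n := by
  wlog ht : 0 ≤ t generalizing t
  · obtain ⟨y, hy, n, hn⟩ := this (-t) (by linarith)
    refine ⟨-y, ?_, n, ?_⟩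
    · rw [abs_sub_comm]; simpa [sub_eq_add_neg, add_comm] using hy
    · rw [mul_neg, Real.cosh_neg, hn]
  have hgap : Real.cosh (Real.pi * t) + 1 ≤ Real.cosh (Real.pi * (t + 1)) := by
    have h1 : 0 ≤ Real.sinh (Real.pi * t) := Real.sinh_nonneg_iff.2 (by positivity)
    have h2 : 0 ≤ Real.sinh Real.pi := Real.sinh_nonneg_iff.2 (by positivity)
    have h3 := Real.one_le_cosh (Real.pi * t)
    have h4 : 2 ≤ Real.cosh Real.pi := by
      have := Real.self_le_sinh_iff.2 Real.pi_pos.le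
      have := Real.pi_gt_three
      have := Real.sinh_lt_cosh Real.pi
      linarith
    rw [mul_add, mul_one, Real.cosh_add]
    nlinarith [mul_nonneg h1 h2]
  have hivt := intermediate_value_Icc (by linarith : t ≤ t + 1)
    (f := fun y => Real.cosh (Real.pi * y))
    (Real.continuous_cosh.comp (by fun_prop)).continuousOn
  have hpos := (Real.cosh_pos (Real.pi * t)).le
  obtain ⟨y, hy, hyn⟩ := hivt (show (⌈Real.cosh (Real.pi * t)⌉₊ : ℝ) ∈ _ from
    ⟨Nat.le_ceil _, (Nat.ceil_lt_add_one hpos).le.trans hgap⟩)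
  exact ⟨y, abs_le.2 ⟨by linarith [hy.1], by linarith [hy.2]⟩, _, hyn⟩

theorem exists_cos_pi_mul_eq_intCast (w : ℂ) :
    ∃ v ∈ ball w 2, ∃ m : ℤ, Complex.cos (Real.pi * v) = m := by
  obtain ⟨y, hy, n, hn⟩ := exists_cosh_pi_mul_eq_natCast w.im
  refine ⟨round w.re + y * Complex.I, ?_, ?_⟩
  · have h := abs_sub_round w.re
    rw [mem_ball, dist_eq_norm]
    refine (Complex.norm_le_abs_re_add_abs_im _).trans_lt ?_
    rw [abs_sub_comm] at h
    have e1 : ((round w.re + y * Complex.I : ℂ) - w).re = round w.re - w.re := by simp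
    have e2 : ((round w.re + y * Complex.I : ℂ) - w).im = y - w.im := by simp
    rw [e1, e2]
    linarith
  · have e1 : (Real.pi * (round w.re + y * Complex.I) : ℂ)
        = ((Real.pi * y : ℝ) : ℂ) * Complex.I + (round w.re : ℤ) * Real.pi := by
      push_cast; ring
    have e2 : Complex.cos (((Real.pi * y : ℝ) : ℂ) * Complex.I) = n := by
      rw [Complex.cos_mul_I, ← Complex.ofReal_cosh, hn]; simp
    rw [e1]
    refine ⟨(round w.re).negOnePow * n, ?_⟩
    rw [Complex.cos_antiperiodic.add_int_mul_eq, e2]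
    push_cast
    rfl

theorem norm_cos_le_exp_norm (w : ℂ) : ‖Complex.cos w‖ ≤ Real.exp ‖w‖ := by
  have h1 := Complex.norm_exp_le_exp_norm (w * Complex.I)
  have h2 := Complex.norm_exp_le_exp_norm (-w * Complex.I)
  simp only [norm_mul, norm_neg, Complex.norm_I, mul_one] at h1 h2
  have h3 := norm_add_le (Complex.exp (w * Complex.I)) (Complex.exp (-w * Complex.I))
  rw [Complex.cos, norm_div, Complex.norm_ofNat]
  linarith

theorem norm_deriv_le_of_forall_cos_pi_mul_ne {g : ℂ → ℂ} {c : ℂ} {R : ℝ} (hR : 0 < R)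
    (hg : DifferentiableOn ℂ g (ball c R))
    (h : ∀ z ∈ ball c R, ∀ m : ℤ, Complex.cos (Real.pi * g z) ≠ m) :
    ‖deriv g c‖ ≤ 192 / R := by
  by_contra! hlt
  have h0 : deriv g c ≠ 0 := norm_pos_iff.1 (lt_trans (by positivity) hlt)
  obtain ⟨w, hw⟩ := exists_ball_subset_image_of_deriv_ne_zero hR hg h0
  obtain ⟨v, hv, m, hm⟩ := exists_cos_pi_mul_eq_intCast w
  rw [div_lt_iff₀ hR] at hlt
  obtain ⟨z, hz, rfl⟩ := hw (ball_subset_ball (by linarith) hv)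
  exact h z hz m hm

/-- A version of **Schottky's theorem**. -/
theorem exists_norm_le_of_forall_ne_zero_ne_one {R : ℝ} (hR : 0 < R) (α : ℝ) :
    ∃ β : ℝ, ∀ (f : ℂ → ℂ) (c : ℂ), DifferentiableOn ℂ f (ball c R) →
      (∀ z ∈ ball c R, f z ≠ 0) → (∀ z ∈ ball c R, f z ≠ 1) → ‖f c‖ ≤ α →
      ∀ z ∈ ball c (R / 2), ‖f z‖ ≤ β := by
  refine ⟨(1 + Real.exp (Real.pi * Real.exp (Real.pi * (2 * α + 195)))) / 2,
    fun f c hf hf0 hf1 hα z hz => ?_⟩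
  obtain ⟨F, hF, hFc, hFe⟩ := exists_cos_pi_mul_eq_on_ball hR (f := fun z => 2 * f z - 1)
    ((hf.const_mul 2).sub_const 1) (fun z hz h => hf1 z hz (by linear_combination h / 2))
    (fun z hz h => hf0 z hz (by linear_combination h / 2))
  have hFint : ∀ z ∈ ball c R, ∀ m : ℤ, F z ≠ m := fun z hz m hm => by
    have h := hFe z hz
    rw [hm, mul_comm (Real.pi : ℂ), ← zero_add ((m : ℂ) * _), Complex.cos_antiperiodic.add_int_mul_eq,
      Complex.cos_zero, mul_one] at h
    rcases Int.even_or_odd m with he | ho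
    · rw [Int.negOnePow_even m he] at h
      push_cast at h
      exact hf1 z hz (by linear_combination h / 2)
    · rw [Int.negOnePow_odd m ho] at h
      push_cast at h
      exact hf0 z hz (by linear_combination h / 2)
  obtain ⟨g, hg, hgc, hge⟩ := exists_cos_pi_mul_eq_on_ball hR hF
    (fun z hz => by simpa using hFint z hz 1) (fun z hz => by simpa using hFint z hz (-1))
  have hgd : ∀ w ∈ ball c (R / 2), ‖deriv g w‖ ≤ 192 / (R / 2) := fun w hw => by
    have hsub : ball w (R / 2) ⊆ ball c R := ball_subset_ball' (by
      have := mem_ball.1 hw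
      linarith)
    refine norm_deriv_le_of_forall_cos_pi_mul_ne (by positivity) (hg.mono hsub) fun z hz m hm => ?_
    exact hFint z (hsub hz) m ((hge z (hsub hz)).trans hm)
  have hsub : ball c (R / 2) ⊆ ball c R := ball_subset_ball (by linarith)
  have hgdiff : ‖g z - g c‖ ≤ 192 / (R / 2) * ‖z - c‖ :=
    (convex_ball c (R / 2)).norm_image_sub_le_of_norm_deriv_le
      (fun x hx => hg.differentiableAt (isOpen_ball.mem_nhds (hsub hx))) hgd
      (mem_ball_self (by positivity)) hz
  have h192 : 192 / (R / 2) * ‖z - c‖ ≤ 192 := by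
    rw [← dist_eq_norm, div_mul_eq_mul_div, div_le_iff₀ (by positivity)]
    have := mem_ball.1 hz
    linarith
  have hfc : ‖2 * f c - 1‖ ≤ 2 * α + 1 := by
    refine (norm_sub_le _ _).trans ?_
    rw [norm_mul, Complex.norm_ofNat, norm_one]
    linarith
  have hgz : ‖g z‖ ≤ 2 * α + 195 := by
    have := norm_sub_norm_le (g z) (g c)
    linarith
  have hpi : ‖(Real.pi : ℂ)‖ = Real.pi := by simp [abs_of_pos Real.pi_pos]
  have hFz : ‖F z‖ ≤ Real.exp (Real.pi * (2 * α + 195)) := by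
    rw [hge z (hsub hz)]
    refine (norm_cos_le_exp_norm _).trans ?_
    rw [norm_mul, hpi]
    gcongr
  have hfz : ‖2 * f z - 1‖ ≤ Real.exp (Real.pi * Real.exp (Real.pi * (2 * α + 195))) := by
    rw [hFe z (hsub hz)]
    refine (norm_cos_le_exp_norm _).trans ?_
    rw [norm_mul, hpi]
    gcongr
  have e : f z = ((2 * f z - 1) + 1) / 2 := by ring
  rw [e, norm_div, Complex.norm_ofNat]
  have := norm_add_le (2 * f z - 1) 1
  rw [norm_one] at this
  linarith

theorem exists_norm_le_on_sphere_of_forall_ne {a b z₀ : ℂ} {R : ℝ} (hab : a ≠ b) (hR : 0 < R)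
    (α : ℝ) :
    ∃ β : ℝ, ∀ f : ℂ → ℂ, DifferentiableOn ℂ f (ball z₀ R) →
      (∀ z ∈ ball z₀ R, z ≠ z₀ → f z ≠ a ∧ f z ≠ b) →
      ∀ z ∈ sphere z₀ (R * Real.exp (-8)), ‖f z‖ ≤ α →
      ∀ w ∈ sphere z₀ (R * Real.exp (-8)), ‖f w‖ ≤ β := by
  have hba : b - a ≠ 0 := sub_ne_zero.2 hab.symm
  obtain ⟨β, hβ⟩ := exists_norm_le_of_forall_ne_zero_ne_one (R := 8) (by norm_num)
    ((α + ‖a‖) / ‖b - a‖)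
  refine ⟨β * ‖b - a‖ + ‖a‖, fun f hf hfab z hz hzα w hw => ?_⟩
  have hRC : (R : ℂ) ≠ 0 := by exact_mod_cast hR.ne'
  have hpolar : ∀ u ∈ sphere z₀ (R * Real.exp (-8)), ∃ θ : ℝ, |θ| ≤ Real.pi ∧
      u = z₀ + R * Complex.exp (-8 + θ * Complex.I) := fun u hu => by
    refine ⟨(u - z₀).arg, Complex.abs_arg_le_pi _, ?_⟩
    have h1 : ‖u - z₀‖ = R * Real.exp (-8) := by rw [← dist_eq_norm]; exact hu
    have h2 := Complex.norm_mul_exp_arg_mul_I (u - z₀)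
    rw [h1] at h2
    rw [Complex.exp_add]
    push_cast at h2
    linear_combination -h2
  -- pulling back along `ζ ↦ z₀ + R * exp ζ` turns the punctured disc into a half-plane
  obtain ⟨h, hh⟩ : ∃ h : ℂ → ℂ, h = fun ζ => (f (z₀ + R * Complex.exp ζ) - a) / (b - a) := ⟨_, rfl⟩
  have hmem : ∀ ζ : ℂ, ζ.re < 0 → z₀ + R * Complex.exp ζ ∈ ball z₀ R := fun ζ hζ => by
    rw [mem_ball, dist_eq_norm, add_sub_cancel_left, norm_mul, Complex.norm_exp,
      Complex.norm_real, Real.norm_of_nonneg hR.le]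
    have := Real.exp_lt_one_iff.2 hζ
    nlinarith
  obtain ⟨θ, -, hzθ⟩ := hpolar z hz
  obtain ⟨τ, hτ, hwτ⟩ : ∃ τ : ℝ, |τ - θ| ≤ Real.pi ∧
      w = z₀ + R * Complex.exp (-8 + τ * Complex.I) := by
    obtain ⟨τ, -, hwτ⟩ := hpolar w hw
    refine ⟨τ + (-round ((τ - θ) / (2 * Real.pi)) : ℤ) * (2 * Real.pi), ?_, ?_⟩
    · have := abs_sub_round ((τ - θ) / (2 * Real.pi))
      have e : τ + ((-round ((τ - θ) / (2 * Real.pi)) : ℤ) : ℝ) * (2 * Real.pi) - θ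
          = ((τ - θ) / (2 * Real.pi) - round ((τ - θ) / (2 * Real.pi))) * (2 * Real.pi) := by
        have := Real.pi_ne_zero
        push_cast
        field_simp
        ring
      rw [e, abs_mul, abs_of_pos Real.two_pi_pos]
      nlinarith [Real.pi_pos]
    · rw [hwτ]
      congr 2
      refine (Complex.exp_eq_exp_iff_exists_int.2
        ⟨-round ((τ - θ) / (2 * Real.pi)), ?_⟩).symm
      push_cast
      ring
  have hre : ∀ ζ ∈ ball (-8 + θ * Complex.I : ℂ) 8, ζ.re < 0 := fun ζ hζ => by
    have h1 := (Complex.abs_re_le_norm (ζ - (-8 + θ * Complex.I))).trans_lt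
      (by rw [← dist_eq_norm]; exact hζ)
    have h2 : (ζ - (-8 + θ * Complex.I)).re = ζ.re + 8 := by simp
    rw [h2, abs_lt] at h1
    linarith [h1.2]
  have hne : ∀ ζ : ℂ, z₀ + R * Complex.exp ζ ≠ z₀ := fun ζ he =>
    mul_ne_zero hRC (Complex.exp_ne_zero ζ) (by linear_combination he)
  have hhd : DifferentiableOn ℂ h (ball (-8 + θ * Complex.I : ℂ) 8) := by
    rw [hh]
    refine ((hf.comp (t := ball z₀ R) (f := fun ζ => z₀ + R * Complex.exp ζ) ?_
      fun ζ hζ => hmem ζ (hre ζ hζ)).sub_const a).div_const _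
    fun_prop
  have hval : ∀ ζ, f (z₀ + R * Complex.exp ζ) = h ζ * (b - a) + a := fun ζ => by
    rw [hh]; field_simp; ring
  have key := hβ h (-8 + θ * Complex.I) hhd
    (fun ζ hζ h0 => (hfab _ (hmem ζ (hre ζ hζ)) (hne ζ)).1 (by rw [hval, h0]; ring))
    (fun ζ hζ h1 => (hfab _ (hmem ζ (hre ζ hζ)) (hne ζ)).2 (by rw [hval, h1]; ring))
    (by
      rw [hh]
      simp only
      rw [← hzθ, norm_div]
      gcongr
      exact (norm_sub_le _ _).trans (by linarith))
    (-8 + τ * Complex.I) (by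
      rw [mem_ball, dist_eq_norm, show (-8 + τ * Complex.I : ℂ) - (-8 + θ * Complex.I)
        = ((τ - θ : ℝ) : ℂ) * Complex.I by push_cast; ring, norm_mul, Complex.norm_I, mul_one,
        Complex.norm_real, Real.norm_eq_abs]
      linarith [Real.pi_lt_four])
  rw [hwτ, hval]
  refine (norm_add_le _ _).trans ?_
  rw [norm_mul]
  gcongr

/-- **Montel's theorem** for a uniformly bounded sequence on a disc. -/
theorem exists_tendstoUniformlyOn_of_norm_le {f : ℕ → ℂ → ℂ} {c : ℂ} {R M : ℝ} (hR : 0 < R)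
    (hf : ∀ n, DifferentiableOn ℂ (f n) (ball c R)) (hM : ∀ n, ∀ z ∈ ball c R, ‖f n z‖ ≤ M) :
    ∃ φ : ℕ → ℕ, StrictMono φ ∧ ∃ g : ℂ → ℂ,
      TendstoUniformlyOn (fun n => f (φ n)) g atTop (closedBall c (R / 2)) := by
  have hsub : closedBall c (R / 2) ⊆ ball c R := closedBall_subset_ball (by linarith)
  have hM0 : 0 ≤ M := (norm_nonneg _).trans (hM 0 c (mem_ball_self hR))
  have hlip : ∀ n, ∀ z ∈ closedBall c (R / 2), ∀ w ∈ closedBall c (R / 2),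
      ‖f n w - f n z‖ ≤ 4 * M / R * ‖w - z‖ := fun n z hz w hw => by
    refine (convex_closedBall c (R / 2)).norm_image_sub_le_of_norm_deriv_le
      (fun x hx => (hf n).differentiableAt (isOpen_ball.mem_nhds (hsub hx)))
      (fun x hx => ?_) hz hw
    have hsub' : closedBall x (R / 4) ⊆ ball c R := closedBall_subset_ball' (by
      have := mem_closedBall.1 hx
      linarith)
    refine (Complex.norm_deriv_le_of_forall_mem_sphere_norm_le (by positivity)
      (((hf n).mono hsub').diffContOnCl_ball subset_rfl)
      (fun y hy => hM n y (hsub' (sphere_subset_closedBall hy)))).trans_eq ?_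
    field_simp
  have : CompactSpace (closedBall c (R / 2)) :=
    isCompact_iff_compactSpace.1 (isCompact_closedBall c (R / 2))
  let F : ℕ → BoundedContinuousFunction (closedBall c (R / 2)) ℂ := fun n =>
    BoundedContinuousFunction.mkOfCompact
      ⟨(closedBall c (R / 2)).domRestrict (f n),
        ((hf n).continuousOn.mono hsub).domRestrict⟩
  have hF : ∀ n x, F n x = f n x := fun n x => rfl
  have hcomp : IsCompact (closure (range F)) := by
    refine BoundedContinuousFunction.arzela_ascoli (closedBall 0 M) (isCompact_closedBall 0 M) _
      ?_ ?_
    · rintro _ x ⟨n, rfl⟩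
      rw [hF, mem_closedBall_zero_iff]
      exact hM n x (hsub x.2)
    · refine LipschitzWith.uniformEquicontinuous _ (Real.toNNReal (4 * M / R)) ?_
        |>.equicontinuous
      rintro ⟨_, n, rfl⟩
      refine LipschitzWith.of_dist_le_mul fun x y => ?_
      rw [Real.coe_toNNReal _ (by positivity), Subtype.dist_eq, dist_eq_norm, dist_eq_norm]
      exact hlip n y y.2 x x.2
  obtain ⟨G, -, φ, hφ, hG⟩ := hcomp.tendsto_subseq (x := F) fun n => subset_closure ⟨n, rfl⟩
  classical
  refine ⟨φ, hφ, fun z => if h : z ∈ closedBall c (R / 2) then G ⟨z, h⟩ else 0, ?_⟩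
  rw [tendstoUniformlyOn_iff_tendstoUniformly_comp_coe]
  have h := BoundedContinuousFunction.tendsto_iff_tendstoUniformly.1 hG
  have hG' : (fun z => if h : z ∈ closedBall c (R / 2) then G ⟨z, h⟩ else 0) ∘ Subtype.val = ⇑G := by
    funext x
    exact dif_pos x.2
  rw [hG']
  exact h

theorem forall_norm_ge_of_forall_mem_sphere {f : ℂ → ℂ} {a b z₀ : ℂ} {r : ℝ} (hab : a ≠ b)
    (hr : 0 < r) (hf : DifferentiableOn ℂ f (closedBall z₀ r))
    (hfab : ∀ z ∈ closedBall z₀ r, z ≠ z₀ → f z ≠ a ∧ f z ≠ b) {M : ℝ} (hM : 0 < M)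
    (hs : ∀ z ∈ sphere z₀ r, M + 2 * (‖a‖ + ‖b‖) ≤ ‖f z‖) :
    ∀ z ∈ closedBall z₀ r, M ≤ ‖f z‖ := by
  obtain ⟨c, hc, hfc⟩ : ∃ c, ‖c‖ ≤ ‖a‖ + ‖b‖ ∧ ∀ z ∈ closedBall z₀ r, f z - c ≠ 0 := by
    by_cases h : f z₀ = a
    · refine ⟨b, by linarith [norm_nonneg a], fun z hz h' => ?_⟩
      rcases eq_or_ne z z₀ with rfl | hne
      · exact hab (h.symm.trans (sub_eq_zero.1 h'))
      · exact (hfab z hz hne).2 (sub_eq_zero.1 h')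
    · refine ⟨a, by linarith [norm_nonneg b], fun z hz h' => ?_⟩
      rcases eq_or_ne z z₀ with rfl | hne
      · exact h (sub_eq_zero.1 h')
      · exact (hfab z hz hne).1 (sub_eq_zero.1 h')
  intro z hz
  have hpos : 0 < M + (‖a‖ + ‖b‖) := by positivity
  have hd : DiffContOnCl ℂ (fun z => (f z - c)⁻¹) (ball z₀ r) :=
    ((hf.sub_const c).inv hfc).diffContOnCl_ball subset_rfl
  have key := Complex.norm_le_of_forall_mem_frontier_norm_le isBounded_ball hd
    (C := (M + (‖a‖ + ‖b‖))⁻¹) (fun w hw => by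
      rw [frontier_ball _ hr.ne'] at hw
      rw [norm_inv]
      have := norm_sub_norm_le (f w) c
      gcongr
      linarith [hs w hw]) (z := z) (by rwa [closure_ball _ hr.ne'])
  rw [norm_inv, inv_le_inv₀ (norm_pos_iff.2 (hfc z hz)) hpos] at key
  linarith [norm_sub_le (f z) c]

theorem isNormalAt_of_forall_ne {𝓕 : Set (ℂ → ℂ)} {D : Set ℂ} {a b z₀ : ℂ} {R : ℝ} (hab : a ≠ b)
    (hR : 0 < R) (hRD : ball z₀ R ⊆ D) (hol : ∀ f ∈ 𝓕, DifferentiableOn ℂ f (ball z₀ R))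
    (hne : ∀ f ∈ 𝓕, ∀ z ∈ ball z₀ R, z ≠ z₀ → f z ≠ a ∧ f z ≠ b) :
    IsNormalAt 𝓕 D z₀ := by
  obtain ⟨r, hr⟩ : ∃ r, r = R * Real.exp (-8) := ⟨_, rfl⟩
  have hr0 : 0 < r := by rw [hr]; positivity
  have hrR : r < R := by
    have : Real.exp (-8) < 1 := Real.exp_lt_one_iff.2 (by norm_num)
    rw [hr]; nlinarith
  have hcb : closedBall z₀ r ⊆ ball z₀ R := closedBall_subset_ball hrR
  have hhalf : ball z₀ (r / 2) ⊆ closedBall z₀ r :=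
    ball_subset_closedBall.trans (closedBall_subset_closedBall (by linarith))
  refine ⟨ball z₀ (r / 2), isOpen_ball, mem_ball_self (by positivity),
    hhalf.trans (hcb.trans hRD), fun f hf => ?_⟩
  by_cases hcase : ∃ α : ℝ, ∃ᶠ n in atTop, ∃ z ∈ sphere z₀ r, ‖f n z‖ ≤ α
  · obtain ⟨α, hα⟩ := hcase
    obtain ⟨φ, hφ, hφα⟩ := extraction_of_frequently_atTop hα
    obtain ⟨β, hβ⟩ := exists_norm_le_on_sphere_of_forall_ne (z₀ := z₀) hab hR α
    have hbd : ∀ n, ∀ z ∈ ball z₀ r, ‖f (φ n) z‖ ≤ β := fun n z hz => by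
      obtain ⟨w, hw, hwα⟩ := hφα n
      refine Complex.norm_le_of_forall_mem_frontier_norm_le isBounded_ball
        (((hol _ (hf _)).mono hcb).diffContOnCl_ball subset_rfl) (fun u hu => ?_)
        (subset_closure hz)
      rw [frontier_ball _ hr0.ne', hr] at hu
      exact hβ _ (hol _ (hf _)) (hne _ (hf _)) w (hr ▸ hw) hwα u hu
    obtain ⟨ψ, hψ, g, hg⟩ := exists_tendstoUniformlyOn_of_norm_le hr0
      (fun n => (hol _ (hf (φ n))).mono (ball_subset_closedBall.trans hcb)) hbd
    have hloc := (hg.mono ball_subset_closedBall).tendstoLocallyUniformlyOn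
    exact ⟨φ ∘ ψ, hφ.comp hψ, Or.inl ⟨g, hloc.differentiableOn (Eventually.of_forall fun n =>
      (hol _ (hf _)).mono (hhalf.trans hcb)) isOpen_ball, hloc⟩⟩
  · push Not at hcase
    refine ⟨id, strictMono_id, Or.inr fun M K hK _ => ?_⟩
    filter_upwards [hcase (max M 1 + 2 * (‖a‖ + ‖b‖))] with n hn z hz
    exact (le_max_left M 1).trans (forall_norm_ge_of_forall_mem_sphere hab hr0
      ((hol _ (hf n)).mono hcb) (fun w hw => hne _ (hf n) w (hcb hw))
      (lt_max_of_lt_right one_pos) (fun w hw => (hn w hw).le) z (hhalf (hK hz)))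

/-- If the Julia like set of `𝓕` is nonempty, then the
exceptional set of `𝓕` contains at most one point. -/
theorem exceptionalSet_subsingleton (D : Set ℂ) (hD : IsOpen D)
    (hDconn : IsConnected D) (𝓕 : Set (ℂ → ℂ))
    (hol : ∀ f ∈ 𝓕, DifferentiableOn ℂ f D)
    (hJ : (juliaLike 𝓕 D).Nonempty) :
    (exceptionalSet 𝓕 D).Subsingleton := by
  intro a ha b hb
  by_contra hab
  obtain ⟨z₀, hz₀, hnot⟩ := hJ
  refine hnot ⟨hz₀, ?_⟩
  have hfin : ((backwardOrbit 𝓕 D a ∪ backwardOrbit 𝓕 D b) \ {z₀}).Finite := (ha.union hb).sdiff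
  obtain ⟨R, hR, hball⟩ := Metric.mem_nhds_iff.1
    ((hD.inter hfin.isClosed.isOpen_compl).mem_nhds ⟨hz₀, fun h => h.2 rfl⟩)
  have hRD : ball z₀ R ⊆ D := hball.trans inter_subset_left
  exact isNormalAt_of_forall_ne hab hR hRD (fun f hf => (hol f hf).mono hRD)
    fun f hf z hz hne => ⟨fun h => (hball hz).2 ⟨Or.inl ⟨hRD hz, f, hf, h⟩, hne⟩,
      fun h => (hball hz).2 ⟨Or.inr ⟨hRD hz, f, hf, h⟩, hne⟩⟩
end

section
/- Let D ⊆ ℂ be a domain, 𝓕 a family of holomorphic functions on D, and z₀ ∈ ℂ. If there exist a point w ∈ J(𝓕) and a deleted neighborhood N \ {w} of w in D such that every f ∈ 𝓕 omits all values of O⁻_𝓕(z₀) on N \ {w}, then O⁻_𝓕(z₀) contains at most one point (hence z₀ ∈ E(𝓕)). -/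
open Filter Topology

open Metric Set

/-- A zero-free holomorphic function on a disc has a holomorphic logarithm,
which may be taken principal at the centre. -/
lemma exists_log_of_ne_zero_on_ball {f : ℂ → ℂ} {c : ℂ} {R : ℝ} (hR : 0 < R)
    (hf : DifferentiableOn ℂ f (ball c R)) (h0 : ∀ z ∈ ball c R, f z ≠ 0) :
    ∃ g : ℂ → ℂ, DifferentiableOn ℂ g (ball c R) ∧ g c = Complex.log (f c) ∧
      ∀ z ∈ ball c R, Complex.exp (g z) = f z := by
  have hq : DifferentiableOn ℂ (fun z => deriv f z / f z) (ball c R) :=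
    (hf.deriv isOpen_ball).div hf h0
  obtain ⟨g, hgc, hg⟩ := hq.isExactOn_ball.with_val_at c (Complex.log (f c))
  have hc : c ∈ ball c R := mem_ball_self hR
  refine ⟨g, fun z hz => (hg z hz).differentiableAt.differentiableWithinAt, hgc, fun z hz => ?_⟩
  have hd : ∀ x ∈ ball c R, HasDerivAt (fun z => Complex.exp (-g z) * f z) 0 x := by
    intro x hx
    have h1 := (hg x hx).neg.cexp.mul (hf.differentiableAt (isOpen_ball.mem_nhds hx)).hasDerivAt
    refine h1.congr_deriv ?_
    have := h0 x hx
    simp only [Pi.neg_apply]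
    field_simp
    ring
  have key := isOpen_ball.is_const_of_deriv_eq_zero (convex_ball c R).isPreconnected
    (fun x hx => (hd x hx).differentiableAt.differentiableWithinAt)
    (fun x hx => (hd x hx).deriv) hz hc
  have hc1 : Complex.exp (-g c) * f c = 1 := by
    rw [hgc, Complex.exp_neg, Complex.exp_log (h0 c hc), inv_mul_cancel₀ (h0 c hc)]
  have h2 : Complex.exp (-g z) * f z = 1 := key.trans hc1
  rw [Complex.exp_neg] at h2
  have := Complex.exp_ne_zero (g z)
  field_simp at h2
  exact h2.symm

/-- For every real `a` there is `x` at distance at most `1` from `a` such that `cosh x ^ 2`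
is an integer. -/
lemma exists_cosh_sq_eq_int_near (a : ℝ) :
    ∃ x : ℝ, |x - a| ≤ 1 ∧ ∃ n : ℤ, Real.cosh x ^ 2 = n := by
  wlog ha : 0 ≤ a generalizing a
  · obtain ⟨x, hx, n, hn⟩ := this (-a) (by linarith)
    refine ⟨-x, ?_, n, by simpa using hn⟩
    rw [← abs_neg]
    convert hx using 2
    ring
  have hs : Real.cosh a ^ 2 + 1 ≤ Real.cosh (a + 1) ^ 2 := by
    rw [Real.cosh_add]
    have h1 := Real.self_le_sinh_iff.2 (zero_le_one (α := ℝ))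
    have h2 := Real.sinh_nonneg_iff.2 ha
    have h3 := Real.cosh_sq (1 : ℝ)
    have h4 := Real.cosh_sq a
    have h5 := Real.one_le_cosh a
    have h6 := Real.one_le_cosh 1
    have h7 : 0 ≤ Real.sinh a * Real.sinh 1 := by positivity
    have h8 : Real.cosh a ^ 2 + 1 ≤ (Real.cosh a * Real.cosh 1) ^ 2 := by
      rw [mul_pow, h3]; nlinarith
    nlinarith [mul_nonneg (mul_nonneg (zero_le_one.trans h5) (zero_le_one.trans h6)) h7]
  have hcont : ContinuousOn (fun x => Real.cosh x ^ 2) (Icc a (a + 1)) := by fun_prop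
  obtain ⟨x, hx, hxn⟩ := intermediate_value_Icc (by linarith) hcont
    (show (⌈Real.cosh a ^ 2⌉ : ℝ) ∈ _ from
      ⟨Int.le_ceil _, (Int.ceil_lt_add_one _).le.trans hs⟩)
  exact ⟨x, by rw [abs_le]; constructor <;> linarith [hx.1, hx.2], _, hxn⟩

/-- Every disc of radius `4` contains a point where `cosh ^ 2` is an integer. -/
lemma exists_complex_cosh_sq_eq_int_near (v : ℂ) :
    ∃ u ∈ ball v 4, ∃ n : ℤ, Complex.cosh u ^ 2 = n := by
  obtain ⟨x, hx, n, hn⟩ := exists_cosh_sq_eq_int_near v.re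
  set m : ℤ := round (v.im / Real.pi)
  have hm : |v.im - m * Real.pi| ≤ Real.pi / 2 := by
    have h := abs_sub_round (v.im / Real.pi)
    have e : v.im - m * Real.pi = (v.im / Real.pi - m) * Real.pi := by
      field_simp
    rw [e, abs_mul, abs_of_pos Real.pi_pos]
    nlinarith [Real.pi_pos]
  refine ⟨x + (m * Real.pi : ℝ) * Complex.I, ?_, n, ?_⟩
  · rw [mem_ball, dist_eq_norm]
    refine (Complex.norm_le_abs_re_add_abs_im _).trans_lt ?_
    have h1 : (x + (m * Real.pi : ℝ) * Complex.I - v).re = x - v.re := by simp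
    have h2 : (x + (m * Real.pi : ℝ) * Complex.I - v).im = m * Real.pi - v.im := by simp
    rw [h1, h2, abs_sub_comm _ v.im]
    linarith [Real.pi_lt_four]
  · have hsin : Complex.sin ((m * Real.pi : ℝ) : ℂ) = 0 := by
      rw [← Complex.ofReal_sin, Real.sin_int_mul_pi, Complex.ofReal_zero]
    have hcos := Complex.sin_sq_add_cos_sq ((m * Real.pi : ℝ) : ℂ)
    rw [hsin] at hcos
    have hcos' : Complex.cos ((m * Real.pi : ℝ) : ℂ) ^ 2 = 1 := by simpa using hcos
    rw [Complex.cosh_add, Complex.cosh_mul_I, Complex.sinh_mul_I, hsin]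
    rw [zero_mul, mul_zero, add_zero, mul_pow, hcos', mul_one]
    exact_mod_cast hn

/-- **Bloch-type estimate**: if the image of the disc `ball c R` under a holomorphic function `g`
contains no disc of radius `L`, then `‖g' c‖ * R ≤ 128 * L`. -/
lemma norm_deriv_mul_le_of_image_contains_no_ball {g : ℂ → ℂ} {c : ℂ} {R L : ℝ} (hR : 0 < R)
    (hL : 0 < L) (hg : DifferentiableOn ℂ g (ball c R))
    (hm : ∀ v, ∃ u ∈ ball v L, u ∉ g '' ball c R) :
    ‖deriv g c‖ * R ≤ 128 * L := by
  set ρ := R / 2 with hρ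
  have hg' : DifferentiableOn ℂ (deriv g) (ball c R) := hg.deriv isOpen_ball
  have hsub : closedBall c ρ ⊆ ball c R := closedBall_subset_ball (by linarith)
  have hcont : ContinuousOn (fun z => ‖deriv g z‖ * (ρ - dist z c)) (closedBall c ρ) :=
    (hg'.continuousOn.mono hsub).norm.mul (by fun_prop)
  obtain ⟨z₁, hz₁, hmax⟩ := (isCompact_closedBall c ρ).exists_isMaxOn
    ⟨c, mem_closedBall_self (by linarith)⟩ hcont
  have hmax' : ∀ z ∈ closedBall c ρ,
      ‖deriv g z‖ * (ρ - dist z c) ≤ ‖deriv g z₁‖ * (ρ - dist z₁ c) := fun z hz => hmax hz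
  have hc := hmax' c (mem_closedBall_self (by linarith))
  rw [dist_self, sub_zero] at hc
  set A := ‖deriv g z₁‖ with hA
  obtain ⟨t, ht⟩ : ∃ t, t = (ρ - dist z₁ c) / 2 := ⟨_, rfl⟩
  have ht0 : 0 ≤ t := by have := mem_closedBall.1 hz₁; linarith
  have hA0 : 0 ≤ A := norm_nonneg _
  suffices h : A * t ≤ 32 * L by
    have h2 : ρ - dist z₁ c = 2 * t := by linarith
    rw [h2, hρ] at hc
    linarith
  rcases ht0.eq_or_lt with h | ht0
  · rw [← h, mul_zero]; positivity
  rcases hA0.eq_or_lt with h | hA0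
  · rw [← h, zero_mul]; positivity
  have hball : ball z₁ t ⊆ closedBall c ρ := fun z hz => by
    have := dist_triangle z z₁ c
    rw [mem_ball] at hz
    rw [mem_closedBall]; linarith
  have hbd : ∀ z ∈ ball z₁ t, ‖deriv g z‖ ≤ 2 * A := fun z hz => by
    have h1 := hmax' z (hball hz)
    have h2 := dist_triangle z z₁ c
    rw [mem_ball] at hz
    have h3 : ‖deriv g z‖ * t ≤ ‖deriv g z‖ * (ρ - dist z c) := by gcongr; linarith
    have h4 : ‖deriv g z‖ * t ≤ (2 * A) * t := by nlinarith
    exact le_of_mul_le_mul_right h4 ht0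
  have hmaps : MapsTo (deriv g) (ball z₁ t) (closedBall (deriv g z₁) (4 * A)) := fun z hz => by
    rw [mem_closedBall, dist_eq_norm]
    linarith [norm_sub_le (deriv g z) (deriv g z₁), hbd z hz]
  have hsch : ∀ z ∈ ball z₁ t, dist (deriv g z) (deriv g z₁) ≤ 4 * A / t * dist z z₁ :=
    fun z hz => Complex.dist_le_div_mul_dist_of_mapsTo_ball
      (hg'.mono (hball.trans hsub)) hmaps hz
  set s := t / 8 with hs
  have hs0 : 0 < s := by positivity
  have hsb : closedBall z₁ s ⊆ ball z₁ t := closedBall_subset_ball (by linarith)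
  have hgd : ∀ z ∈ ball z₁ t, HasDerivAt g (deriv g z) z := fun z hz =>
    (hg.differentiableAt (isOpen_ball.mem_nhds (hsub (hball hz)))).hasDerivAt
  have hlow : ∀ z ∈ sphere z₁ s, A * s / 2 ≤ ‖g z - g z₁‖ := by
    intro z hz
    have h1 := (convex_closedBall z₁ s).norm_image_sub_le_of_norm_hasDerivWithin_le
      (f := fun z => g z - deriv g z₁ * z) (f' := fun z => deriv g z - deriv g z₁)
      (C := A / 2) (x := z₁) (y := z)
      (fun x hx => by
        have := (hgd x (hsb hx)).sub ((hasDerivAt_id x).const_mul (deriv g z₁))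
        simp only [mul_one] at this
        exact this.hasDerivWithinAt)
      (fun x hx => by
        rw [← dist_eq_norm]
        refine (hsch x (hsb hx)).trans ?_
        have : dist x z₁ ≤ s := hx
        calc 4 * A / t * dist x z₁ ≤ 4 * A / t * s := by gcongr
          _ = A / 2 := by rw [hs]; field_simp; norm_num)
      (mem_closedBall_self hs0.le) (sphere_subset_closedBall hz)
    have hzs : ‖z - z₁‖ = s := by rw [← dist_eq_norm]; exact hz
    rw [hzs] at h1
    have h2 : ‖deriv g z₁ * (z - z₁)‖ = A * s := by rw [norm_mul, hzs]
    have h3 : deriv g z₁ * (z - z₁) =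
        (g z - g z₁) - ((g z - deriv g z₁ * z) - (g z₁ - deriv g z₁ * z₁)) := by ring
    have h4 := norm_sub_le (g z - g z₁) ((g z - deriv g z₁ * z) - (g z₁ - deriv g z₁ * z₁))
    rw [← h3, h2] at h4
    linarith
  have hdc : DiffContOnCl ℂ g (ball z₁ s) :=
    DifferentiableOn.diffContOnCl (by
      rw [closure_ball z₁ hs0.ne']
      exact hg.mono (hsb.trans (hball.trans hsub)))
  have hne : ∃ᶠ z in 𝓝 z₁, g z ≠ g z₁ := by
    have := (hgd z₁ (mem_ball_self ht0)).eventually_ne (c := g z₁) (norm_pos_iff.1 hA0)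
    exact this.frequently.filter_mono nhdsWithin_le_nhds
  have himg := hdc.ball_subset_image_closedBall hs0 hlow hne
  by_contra! hlt
  obtain ⟨u, hu, hu'⟩ := hm (g z₁)
  refine hu' (image_mono (hsb.trans (hball.trans hsub)) (himg (ball_subset_ball ?_ hu)))
  rw [hs]; linarith

/-- A holomorphic function on a disc omitting `0` and `1` is of the form `cosh ^ 2 ∘ g`, with
control on `g` at the centre. -/
lemma exists_cosh_sq_of_omits {F : ℂ → ℂ} {c : ℂ} {R B : ℝ} (hR : 0 < R)
    (hF : DifferentiableOn ℂ F (ball c R)) (h0 : ∀ z ∈ ball c R, F z ≠ 0)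
    (h1 : ∀ z ∈ ball c R, F z ≠ 1) (hB : 1 ≤ B) (hFc : ‖F c‖ ≤ B) :
    ∃ g : ℂ → ℂ, DifferentiableOn ℂ g (ball c R) ∧ ‖g c‖ ≤ 3 * B + 4 ∧
      ∀ z ∈ ball c R, Complex.cosh (g z) ^ 2 = F z := by
  have hc : c ∈ ball c R := mem_ball_self hR
  obtain ⟨a, ha, -, hae⟩ := exists_log_of_ne_zero_on_ball hR hF h0
  obtain ⟨b, hb, -, hbe⟩ := exists_log_of_ne_zero_on_ball hR (hF.sub_const 1)
    (fun z hz => sub_ne_zero.2 (h1 z hz))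
  set p : ℂ → ℂ := fun z => Complex.exp (a z / 2) with hp
  set q : ℂ → ℂ := fun z => Complex.exp (b z / 2) with hq
  have hpd : DifferentiableOn ℂ p (ball c R) := (ha.div_const 2).cexp
  have hqd : DifferentiableOn ℂ q (ball c R) := (hb.div_const 2).cexp
  have hp2 : ∀ z ∈ ball c R, p z ^ 2 = F z := fun z hz => by
    rw [← hae z hz, hp, ← Complex.exp_nat_mul]; congr 1; push_cast; ring
  have hq2 : ∀ z ∈ ball c R, q z ^ 2 = F z - 1 := fun z hz => by
    rw [← hbe z hz, hq, ← Complex.exp_nat_mul]; congr 1; push_cast; ring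
  have hpq : ∀ z ∈ ball c R, (p z + q z) * (p z - q z) = 1 := fun z hz => by
    linear_combination hp2 z hz - hq2 z hz
  have hne : ∀ z ∈ ball c R, p z + q z ≠ 0 := fun z hz h => by
    have := hpq z hz
    rw [h, zero_mul] at this
    exact zero_ne_one this
  obtain ⟨g, hg, hgc, hge⟩ := exists_log_of_ne_zero_on_ball hR (hpd.add hqd) hne
  refine ⟨g, hg, ?_, fun z hz => ?_⟩
  · have hpn : ‖p c‖ ≤ B := by
      have : ‖p c‖ ^ 2 ≤ B := by rw [← norm_pow, hp2 c hc]; exact hFc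
      nlinarith [norm_nonneg (p c)]
    have hqn : ‖q c‖ ≤ 2 * B := by
      have : ‖q c‖ ^ 2 ≤ B + 1 := by
        rw [← norm_pow, hq2 c hc]
        exact (norm_sub_le _ _).trans (by simpa using hFc)
      nlinarith [norm_nonneg (q c)]
    have hu : ‖p c + q c‖ ≤ 3 * B := (norm_add_le _ _).trans (by linarith)
    have hv : ‖p c - q c‖ ≤ 3 * B := (norm_sub_le _ _).trans (by linarith)
    have hpos : 0 < ‖p c + q c‖ := norm_pos_iff.2 (hne c hc)
    have hinv : ‖p c + q c‖⁻¹ ≤ 3 * B := by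
      rw [eq_inv_of_mul_eq_one_right (hpq c hc), norm_inv] at hv
      exact hv
    have hl1 := Real.log_le_self hpos.le
    have hl2 := Real.log_le_self (inv_pos.2 hpos).le
    rw [Real.log_inv] at hl2
    rw [hgc]
    refine (Complex.norm_le_abs_re_add_abs_im _).trans ?_
    simp only [Complex.log_re, Complex.log_im, Pi.add_apply]
    have := Complex.abs_arg_le_pi (p c + q c)
    have h3 : |Real.log ‖p c + q c‖| ≤ 3 * B := abs_le.2 ⟨by linarith, by linarith⟩
    linarith [Real.pi_lt_four]
  · have e1 : Complex.exp (g z) = p z + q z := hge z hz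
    have e2 : Complex.exp (-g z) = p z - q z := by
      rw [Complex.exp_neg, e1]
      exact (eq_inv_of_mul_eq_one_right (hpq z hz)).symm
    rw [Complex.cosh, e1, e2, ← hp2 z hz]
    ring

/-- **Schottky's theorem**, for values at the centre that are at least `1 / 2`. -/
lemma schottky_of_half_le (M : ℝ) : ∃ C : ℝ, ∀ (f : ℂ → ℂ) (c : ℂ) (R : ℝ), 0 < R →
    DifferentiableOn ℂ f (ball c R) → (∀ z ∈ ball c R, f z ≠ 0) → (∀ z ∈ ball c R, f z ≠ 1) →
    1 / 2 ≤ ‖f c‖ → ‖f c‖ ≤ M → ∀ z ∈ ball c (R / 2), ‖f z‖ ≤ C := by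
  set B : ℝ := |M| + 6 with hB
  set G : ℝ := 3 * B + 4 + 512 with hG
  refine ⟨Real.exp (8 * Real.exp (2 * G)), fun f c R hR hf h0 h1 hlow hup z hz => ?_⟩
  have hc : c ∈ ball c R := mem_ball_self hR
  obtain ⟨l, hl, hlc, hle⟩ := exists_log_of_ne_zero_on_ball hR hf h0
  have hpi : (2 * Real.pi * Complex.I : ℂ) ≠ 0 := Complex.two_pi_I_ne_zero
  set F : ℂ → ℂ := fun z => l z / (2 * Real.pi * Complex.I) with hF
  have hFd : DifferentiableOn ℂ F (ball c R) := hl.div_const _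
  have hFe : ∀ z ∈ ball c R, Complex.exp (2 * Real.pi * Complex.I * F z) = f z := fun z hz => by
    rw [← hle z hz, hF]; congr 1; field_simp
  have hFint : ∀ z ∈ ball c R, ∀ n : ℤ, F z ≠ n := fun z hz n h => h1 z hz <| by
    rw [← hFe z hz, h, mul_comm, Complex.exp_int_mul_two_pi_mul_I]
  have hnpi : ‖(2 * Real.pi * Complex.I : ℂ)‖ = 2 * Real.pi := by
    simp [abs_of_pos Real.pi_pos]
  have hFc : ‖F c‖ ≤ B := by
    have hlb : ‖l c‖ ≤ B := by
      rw [hlc]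
      refine (Complex.norm_le_abs_re_add_abs_im _).trans ?_
      simp only [Complex.log_re, Complex.log_im]
      have := Complex.abs_arg_le_pi (f c)
      have hpos : 0 < ‖f c‖ := by linarith
      have hl1 := Real.log_le_self hpos.le
      have hl2 := Real.log_le_self (inv_pos.2 hpos).le
      rw [Real.log_inv] at hl2
      have : ‖f c‖⁻¹ ≤ 2 := by
        rw [inv_le_comm₀ hpos two_pos]; linarith
      have := le_abs_self M
      have h3 : |Real.log ‖f c‖| ≤ |M| + 2 :=
        abs_le.2 ⟨by linarith [abs_nonneg M], by linarith⟩
      linarith [Real.pi_lt_four]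
    rw [hF, norm_div, hnpi]
    refine (div_le_self (norm_nonneg _) ?_).trans hlb
    linarith [Real.pi_gt_three]
  obtain ⟨g, hg, hgc, hge⟩ := exists_cosh_sq_of_omits hR hFd
    (fun z hz => by simpa using hFint z hz 0) (fun z hz => by simpa using hFint z hz 1)
    (by linarith [abs_nonneg M]) hFc
  have hderiv : ∀ x ∈ ball c (R / 2), ‖deriv g x‖ ≤ 512 / (R / 2) := by
    intro x hx
    have hsub : ball x (R / 2) ⊆ ball c R := ball_subset_ball' (by
      rw [mem_ball] at hx; linarith)
    rw [le_div_iff₀ (by positivity)]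
    refine (norm_deriv_mul_le_of_image_contains_no_ball (L := 4) (by positivity) (by norm_num)
      (hg.mono hsub) fun v => ?_).trans (by norm_num)
    obtain ⟨u, hu, n, hn⟩ := exists_complex_cosh_sq_eq_int_near v
    refine ⟨u, hu, ?_⟩
    rintro ⟨y, hy, rfl⟩
    exact hFint y (hsub hy) n (by rw [← hge y (hsub hy), hn])
  have hgz : ‖g z‖ ≤ G := by
    have h2 := (convex_ball c (R / 2)).norm_image_sub_le_of_norm_deriv_le
      (fun x hx => hg.differentiableAt
        (isOpen_ball.mem_nhds (ball_subset_ball (by linarith) hx)))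
      hderiv (mem_ball_self (by positivity)) hz
    have h3 : 512 / (R / 2) * ‖z - c‖ ≤ 512 := by
      rw [mem_ball, dist_eq_norm] at hz
      calc 512 / (R / 2) * ‖z - c‖ ≤ 512 / (R / 2) * (R / 2) := by gcongr
        _ = 512 := by field_simp
    have := norm_le_norm_add_norm_sub' (g z) (g c)
    linarith
  have hzR : z ∈ ball c R := ball_subset_ball (by linarith) hz
  have hcosh : ‖Complex.cosh (g z)‖ ≤ Real.exp G := by
    rw [Complex.cosh, norm_div]
    have e1 := Complex.norm_exp_le_exp_norm (g z)
    have e2 := Complex.norm_exp_le_exp_norm (-g z)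
    rw [norm_neg] at e2
    have e3 := Real.exp_le_exp.2 hgz
    have := norm_add_le (Complex.exp (g z)) (Complex.exp (-g z))
    rw [Complex.norm_two]
    linarith
  have hFz : ‖F z‖ ≤ Real.exp (2 * G) := by
    rw [← hge z hzR, norm_pow, two_mul, Real.exp_add, ← sq]
    gcongr
  rw [← hFe z hzR]
  refine (Complex.norm_exp_le_exp_norm _).trans (Real.exp_le_exp.2 ?_)
  rw [norm_mul, hnpi]
  gcongr
  linarith [Real.pi_lt_four]

/-- **Schottky's theorem**. -/
theorem schottky (M : ℝ) : ∃ C : ℝ, ∀ (f : ℂ → ℂ) (c : ℂ) (R : ℝ), 0 < R →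
    DifferentiableOn ℂ f (ball c R) → (∀ z ∈ ball c R, f z ≠ 0) → (∀ z ∈ ball c R, f z ≠ 1) →
    ‖f c‖ ≤ M → ∀ z ∈ ball c (R / 2), ‖f z‖ ≤ C := by
  obtain ⟨C, hC⟩ := schottky_of_half_le (M + 1)
  refine ⟨C + 1, fun f c R hR hf h0 h1 hM z hz => ?_⟩
  rcases le_total (1 / 2) ‖f c‖ with h | h
  · linarith [hC f c R hR hf h0 h1 h (by linarith) z hz]
  · have e1 := norm_sub_norm_le 1 (f c)
    have e2 := norm_sub_le 1 (f c)
    rw [norm_one] at e1 e2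
    have := hC (fun z => 1 - f z) c R hR (hf.const_sub 1)
      (fun z hz => sub_ne_zero.2 (h1 z hz).symm)
      (fun z hz h => h0 z hz (by simpa using h)) (by linarith) (by linarith) z hz
    have e3 := norm_sub_le 1 (1 - f z)
    rw [norm_one, sub_sub_cancel] at e3
    linarith

/-- A form of Schottky's theorem around a puncture: for holomorphic functions omitting `a ≠ b` on
a punctured disc, the values on a small concentric circle are comparable. -/
lemma exists_bound_on_sphere_of_omits {a b : ℂ} (hab : a ≠ b) (M : ℝ) :
    ∃ C : ℝ, ∀ (f : ℂ → ℂ) (w : ℂ) (R : ℝ), 0 < R →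
      DifferentiableOn ℂ f (ball w R \ {w}) → (∀ z ∈ ball w R \ {w}, f z ≠ a) →
      (∀ z ∈ ball w R \ {w}, f z ≠ b) → ∀ z ∈ sphere w (R * Real.exp (-20)),
        ∀ z' ∈ sphere w (R * Real.exp (-20)), ‖f z‖ ≤ M → ‖f z'‖ ≤ C := by
  have hba : b - a ≠ 0 := sub_ne_zero.2 hab.symm
  obtain ⟨C, hC⟩ := schottky ((M + ‖a‖) / ‖b - a‖)
  refine ⟨C * ‖b - a‖ + ‖a‖, fun f w R hR hf ha hb z hz z' hz' hM => ?_⟩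
  have hRc : (R : ℂ) ≠ 0 := Complex.ofReal_ne_zero.2 hR.ne'
  have hlog : ∀ y ∈ sphere w (R * Real.exp (-20)), ∃ ζ : ℂ,
      w + R * Complex.exp ζ = y ∧ ζ.re = -20 ∧ |ζ.im| ≤ Real.pi := by
    intro y hy
    have hn : ‖(y - w) / R‖ = Real.exp (-20) := by
      rw [mem_sphere, dist_eq_norm] at hy
      rw [norm_div, hy, Complex.norm_of_nonneg hR.le]
      field_simp
    have h0 : (y - w) / R ≠ 0 := norm_pos_iff.1 (by rw [hn]; positivity)
    refine ⟨Complex.log ((y - w) / R), ?_, ?_, ?_⟩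
    · rw [Complex.exp_log h0]; field_simp; ring
    · rw [Complex.log_re, hn, Real.log_exp]
    · rw [Complex.log_im]; exact Complex.abs_arg_le_pi _
  obtain ⟨ζ, rfl, hre, him⟩ := hlog z hz
  obtain ⟨ξ, rfl, hre', him'⟩ := hlog z' hz'
  have hmaps : ∀ y ∈ ball ζ 20, w + R * Complex.exp y ∈ ball w R \ {w} := by
    intro y hy
    refine ⟨?_, ?_⟩
    · rw [mem_ball, dist_eq_norm, add_sub_cancel_left, norm_mul, Complex.norm_of_nonneg hR.le,
        Complex.norm_exp]
      have h1 := (Complex.abs_re_le_norm (y - ζ)).trans_lt (by rwa [mem_ball, dist_eq_norm] at hy)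
      rw [Complex.sub_re, hre, abs_lt] at h1
      exact mul_lt_of_lt_one_right hR (Real.exp_lt_one_iff.2 (by linarith))
    · simp [hRc]
  have key := hC (fun y => (f (w + R * Complex.exp y) - a) / (b - a)) ζ 20 (by norm_num)
    (((hf.comp (by fun_prop) hmaps).sub_const a).div_const _)
    (fun y hy => div_ne_zero (sub_ne_zero.2 (ha _ (hmaps y hy))) hba)
    (fun y hy h => hb _ (hmaps y hy) (sub_left_inj.1 ((div_eq_one_iff_eq hba).1 h)))
    (by
      rw [norm_div]
      gcongr
      exact (norm_sub_le _ _).trans (by gcongr))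
    ξ (by
      rw [mem_ball, dist_eq_norm]
      refine (Complex.norm_le_abs_re_add_abs_im _).trans_lt ?_
      rw [Complex.sub_re, Complex.sub_im, hre, hre', sub_self, abs_zero, zero_add]
      have := abs_sub ξ.im ζ.im
      linarith [Real.pi_lt_four])
  rw [norm_div, div_le_iff₀ (norm_pos_iff.2 hba)] at key
  linarith [norm_le_norm_add_norm_sub' (f (w + R * Complex.exp ξ)) a]

/-- **Montel's theorem** on a disc: a uniformly bounded sequence of holomorphic functions has a
subsequence converging locally uniformly on a smaller disc. -/
lemma exists_subseq_tendstoLocallyUniformlyOn_of_bounded {f : ℕ → ℂ → ℂ} {w : ℂ} {r C : ℝ}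
    (hr : 0 < r) (hf : ∀ n, DifferentiableOn ℂ (f n) (ball w r))
    (hC : ∀ n, ∀ z ∈ ball w r, ‖f n z‖ ≤ C) :
    ∃ φ : ℕ → ℕ, StrictMono φ ∧ ∃ g : ℂ → ℂ, DifferentiableOn ℂ g (ball w (r / 2)) ∧
      TendstoLocallyUniformlyOn (fun n => f (φ n)) g atTop (ball w (r / 2)) := by
  have hsub : closedBall w (r / 2) ⊆ ball w r := closedBall_subset_ball (by linarith)
  have hderiv : ∀ n, ∀ x ∈ closedBall w (r / 2), ‖deriv (f n) x‖ ≤ C / (r / 4) := by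
    intro n x hx
    have hx' : closedBall x (r / 4) ⊆ ball w r := fun y hy => by
      rw [mem_closedBall] at hx hy
      rw [mem_ball]
      linarith [dist_triangle y x w]
    refine Complex.norm_deriv_le_of_forall_mem_sphere_norm_le (by positivity)
      (DifferentiableOn.diffContOnCl ?_) fun z hz => hC n z (hx' (sphere_subset_closedBall hz))
    rw [closure_ball x (by positivity)]
    exact (hf n).mono hx'
  have : CompactSpace (closedBall w (r / 2)) :=
    isCompact_iff_compactSpace.1 (isCompact_closedBall w (r / 2))
  let F : ℕ → BoundedContinuousFunction (closedBall w (r / 2)) ℂ := fun n =>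
    BoundedContinuousFunction.mkOfCompact
      ⟨(closedBall w (r / 2)).domRestrict (f n), ((hf n).continuousOn.mono hsub).domRestrict⟩
  have hF : ∀ n x, F n x = f n x := fun _ _ => rfl
  have hcomp : IsCompact (closure (range F)) := by
    refine BoundedContinuousFunction.arzela_ascoli (closedBall 0 C) (isCompact_closedBall _ _) _
      ?_ ?_
    · rintro _ x ⟨n, rfl⟩
      rw [mem_closedBall_zero_iff, hF]
      exact hC n x (hsub x.2)
    · refine Metric.equicontinuous_of_continuity_modulus (fun t => C / (r / 4) * t) ?_ _ ?_
      · have : Continuous (fun t : ℝ => C / (r / 4) * t) := by fun_prop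
        simpa using this.tendsto 0
      · rintro x y ⟨_, n, rfl⟩
        change dist (F n x) (F n y) ≤ _
        rw [hF, hF, dist_eq_norm, Subtype.dist_eq, dist_eq_norm]
        exact (convex_closedBall w (r / 2)).norm_image_sub_le_of_norm_deriv_le
          (fun z hz => (hf n).differentiableAt (isOpen_ball.mem_nhds (hsub hz)))
          (hderiv n) y.2 x.2
  obtain ⟨G, -, φ, hφ, hG⟩ := hcomp.tendsto_subseq (fun n => subset_closure (mem_range_self n))
  classical
  let g : ℂ → ℂ := fun z => if h : z ∈ closedBall w (r / 2) then G ⟨z, h⟩ else 0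
  have hunif : TendstoUniformlyOn (fun n => f (φ n)) g atTop (ball w (r / 2)) := by
    have h1 := BoundedContinuousFunction.tendsto_iff_tendstoUniformly.1 hG
    rw [Metric.tendstoUniformly_iff] at h1
    rw [Metric.tendstoUniformlyOn_iff]
    intro ε hε
    filter_upwards [h1 ε hε] with n hn z hz
    have hz' := ball_subset_closedBall hz
    have := hn ⟨z, hz'⟩
    simpa only [g, dif_pos hz', hF, Function.comp_apply] using this
  have hloc := hunif.tendstoLocallyUniformlyOn
  exact ⟨φ, hφ, g, hloc.differentiableOn
    (Eventually.of_forall fun n => (hf _).mono (ball_subset_closedBall.trans hsub)) isOpen_ball,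
    hloc⟩

/-- **Montel's fundamental normality test** at a puncture: a sequence of holomorphic functions on
a disc omitting two values `a ≠ b` away from the centre has, near the centre, a subsequence
converging locally uniformly to a holomorphic function or to `∞`. -/
theorem exists_subseq_of_omits_on_punctured_ball {a b w : ℂ} (hab : a ≠ b) {R : ℝ} (hR : 0 < R)
    {f : ℕ → ℂ → ℂ} (hf : ∀ n, DifferentiableOn ℂ (f n) (ball w R))
    (ha : ∀ n, ∀ z ∈ ball w R \ {w}, f n z ≠ a) (hb : ∀ n, ∀ z ∈ ball w R \ {w}, f n z ≠ b) :
    ∃ φ : ℕ → ℕ, StrictMono φ ∧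
      ((∃ g : ℂ → ℂ, DifferentiableOn ℂ g (ball w (R * Real.exp (-20) / 2)) ∧
        TendstoLocallyUniformlyOn (fun n => f (φ n)) g atTop
          (ball w (R * Real.exp (-20) / 2))) ∨
        TendstoInftyLocallyUniformlyOn (fun n => f (φ n)) (ball w (R * Real.exp (-20) / 2))) := by
  set r := R * Real.exp (-20) with hr
  have hr0 : 0 < r := by positivity
  have hrR : r < R := mul_lt_of_lt_one_right hR (Real.exp_lt_one_iff.2 (by norm_num))
  have hsub : closedBall w r ⊆ ball w R := closedBall_subset_ball hrR
  have hcl : closure (ball w r) = closedBall w r := closure_ball w hr0.ne'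
  have hfr : frontier (ball w r) = sphere w r := frontier_ball w hr0.ne'
  have hcirc : ∀ M : ℝ, ∃ C : ℝ, ∀ n, ∀ z ∈ sphere w r, ∀ z' ∈ sphere w r,
      ‖f n z‖ ≤ M → ‖f n z'‖ ≤ C := fun M => by
    obtain ⟨C, hC⟩ := exists_bound_on_sphere_of_omits hab M
    exact ⟨C, fun n => hC (f n) w R hR ((hf n).mono sdiff_subset) (ha n) (hb n)⟩
  obtain ⟨p, hp⟩ : (sphere w r).Nonempty := NormedSpace.sphere_nonempty.2 hr0.le
  by_cases hcase : ∃ M : ℝ, ∃ᶠ n in atTop, ‖f n p‖ ≤ M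
  · obtain ⟨M, hM⟩ := hcase
    obtain ⟨φ, hφ, hφM⟩ := extraction_of_frequently_atTop hM
    obtain ⟨C, hC⟩ := hcirc M
    obtain ⟨ψ, hψ, hg⟩ := exists_subseq_tendstoLocallyUniformlyOn_of_bounded (C := C) hr0
      (fun n => (hf (φ n)).mono (ball_subset_closedBall.trans hsub)) fun n z hz =>
        Complex.norm_le_of_forall_mem_frontier_norm_le isBounded_ball
          (DifferentiableOn.diffContOnCl (by rw [hcl]; exact (hf (φ n)).mono hsub))
          (fun y hy => hC (φ n) p hp y (hfr ▸ hy) (hφM n)) (subset_closure hz)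
    exact ⟨φ ∘ ψ, hφ.comp hψ, Or.inl hg⟩
  · push Not at hcase
    have hlarge : ∀ M : ℝ, ∀ᶠ n in atTop, ∀ z ∈ sphere w r, M ≤ ‖f n z‖ := fun M => by
      obtain ⟨C, hC⟩ := hcirc M
      filter_upwards [hcase C] with n hn z hz
      by_contra! h
      exact (hC n z hz p hp h.le).not_gt hn
    obtain ⟨d, hd, hdw⟩ : ∃ d, (∀ n, ∀ z ∈ ball w R \ {w}, f n z ≠ d) ∧
        ∃ᶠ n in atTop, f n w ≠ d := by
      have h : ∃ᶠ n in atTop, f n w ≠ a ∨ f n w ≠ b :=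
        (Eventually.of_forall fun n => by
          by_contra! h
          exact hab (h.1.symm.trans h.2)).frequently
      rcases frequently_or_distrib.1 h with h | h
      exacts [⟨a, ha, h⟩, ⟨b, hb, h⟩]
    obtain ⟨φ, hφ, hφd⟩ := extraction_of_frequently_atTop hdw
    refine ⟨φ, hφ, Or.inr fun M K hK _ => ?_⟩
    filter_upwards [hφ.tendsto_atTop.eventually (hlarge (|M| + 1 + ‖d‖ + ‖d‖))] with n hn z hz
    have hne : ∀ y ∈ ball w R, f (φ n) y - d ≠ 0 := fun y hy => sub_ne_zero.2 <| by
      by_cases hyw : y = w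
      · rw [hyw]; exact hφd n
      · exact hd _ y ⟨hy, hyw⟩
    have hpos : 0 < |M| + 1 + ‖d‖ := by positivity
    have hzr : z ∈ ball w r := ball_subset_ball (by linarith) (hK hz)
    have hinv : ‖(f (φ n) z - d)⁻¹‖ ≤ (|M| + 1 + ‖d‖)⁻¹ :=
      Complex.norm_le_of_forall_mem_frontier_norm_le (f := fun y => (f (φ n) y - d)⁻¹)
        isBounded_ball
        (DifferentiableOn.diffContOnCl (by
          rw [hcl]
          exact (((hf (φ n)).mono hsub).sub_const d).inv fun y hy => hne y (hsub hy)))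
        (fun y hy => by
          rw [hfr] at hy
          rw [norm_inv]
          gcongr
          linarith [hn y hy, norm_sub_norm_le (f (φ n) y) d])
        (subset_closure hzr)
    rw [norm_inv, inv_le_inv₀ (norm_pos_iff.2 (hne z (hsub (ball_subset_closedBall hzr)))) hpos]
      at hinv
    linarith [norm_sub_le (f (φ n) z) d, le_abs_self M]

/-- If every `f ∈ 𝓕` omits all values of the backward orbit
`O⁻_𝓕(z₀)` on a deleted neighborhood `N \ {w}` in `D` of some point
`w ∈ J(𝓕)`, then `O⁻_𝓕(z₀)` contains at most one point, and hence
`z₀ ∈ E(𝓕)`. -/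
theorem backwardOrbit_subsingleton_of_omitted (D : Set ℂ) (hD : IsOpen D)
    (hDconn : IsConnected D) (𝓕 : Set (ℂ → ℂ))
    (hol : ∀ f ∈ 𝓕, DifferentiableOn ℂ f D) (z₀ : ℂ)
    (h : ∃ w ∈ juliaLike 𝓕 D, ∃ N : Set ℂ, N ∈ 𝓝 w ∧ N ⊆ D ∧
      ∀ f ∈ 𝓕, ∀ z ∈ N \ {w}, f z ∉ backwardOrbit 𝓕 D z₀) :
    (backwardOrbit 𝓕 D z₀).Subsingleton ∧ z₀ ∈ exceptionalSet 𝓕 D := by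
  obtain ⟨w, ⟨hwD, hwF⟩, N, hN, hND, hom⟩ := h
  suffices hs : (backwardOrbit 𝓕 D z₀).Subsingleton from ⟨hs, hs.finite⟩
  intro a ha b hb
  by_contra hab
  obtain ⟨R, hR, hRN⟩ := Metric.mem_nhds_iff.1 hN
  have hr : 0 < R * Real.exp (-20) / 2 := by positivity
  have hle : R * Real.exp (-20) / 2 ≤ R := by
    have := mul_lt_of_lt_one_right hR (Real.exp_lt_one_iff.2 (show (-20 : ℝ) < 0 by norm_num))
    linarith
  refine hwF ⟨hwD, ball w (R * Real.exp (-20) / 2), isOpen_ball, mem_ball_self hr,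
    (ball_subset_ball hle).trans (hRN.trans hND), fun f hf => ?_⟩
  exact exists_subseq_of_omits_on_punctured_ball hab hR
    (fun n => (hol _ (hf n)).mono (hRN.trans hND))
    (fun n z hz hza => hom _ (hf n) z ⟨hRN hz.1, hz.2⟩ (hza ▸ ha))
    (fun n z hz hzb => hom _ (hf n) z ⟨hRN hz.1, hz.2⟩ (hzb ▸ hb))
end

section
/- Let 𝓕 be a family of entire functions with F(𝓕) ≠ ∅. Then the set F_∞(𝓕) = {z ∈ F(𝓕) : there is a sequence {fₙ} ⊆ 𝓕 with fₙ(z) → ∞} is both open and closed as a subset of the topological space F(𝓕). -/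
open Filter Topology

/-- The set `F_∞(𝓕)` of points of the Fatou like set at which some sequence
from `𝓕` tends to `∞`. -/
def fatouInfty (𝓕 : Set (ℂ → ℂ)) (D : Set ℂ) : Set ℂ :=
  {z ∈ fatouLike 𝓕 D | ∃ g : ℕ → ℂ → ℂ, (∀ n, g n ∈ 𝓕) ∧
    Tendsto (fun n => ‖g n z‖) atTop atTop}

/-- Every point of the Fatou like set has an open neighborhood that lies in `F_∞` as soon as it
meets `F_∞`. -/
theorem exists_isOpen_subset_fatouInfty {𝓕 : Set (ℂ → ℂ)} {D : Set ℂ} {z₀ : ℂ}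
    (hz₀ : z₀ ∈ fatouLike 𝓕 D) :
    ∃ U : Set ℂ, IsOpen U ∧ z₀ ∈ U ∧
      ∀ w ∈ U, w ∈ fatouInfty 𝓕 D → U ⊆ fatouInfty 𝓕 D := by
  obtain ⟨-, U, hU, hzU, hUD, hnormal⟩ := hz₀
  refine ⟨U, hU, hzU, fun w hw ⟨_, f, hf, hfw⟩ z hz => ?_⟩
  refine ⟨⟨hUD hz, U, hU, hz, hUD, hnormal⟩, ?_⟩
  obtain ⟨φ, hφ, ⟨g, -, hg⟩ | hinfty⟩ := hnormal f hf
  · exact absurd (hfw.comp hφ.tendsto_atTop)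
      (not_tendsto_atTop_of_tendsto_nhds (hg.tendsto_at hw).norm)
  · refine ⟨fun n => f (φ n), fun n => hf _, tendsto_atTop.2 fun M => ?_⟩
    filter_upwards [hinfty M {z} (Set.singleton_subset_iff.2 hz) isCompact_singleton] with n hn
    exact hn z rfl

/-- For a family `𝓕` of entire functions with nonempty Fatou
like set, `F_∞(𝓕)` is both open and closed as a subset of the topological
space `F(𝓕)`. -/
theorem fatouInfty_isOpen_isClosed (𝓕 : Set (ℂ → ℂ))
    (hent : ∀ f ∈ 𝓕, Differentiable ℂ f)
    (hF : (fatouLike 𝓕 Set.univ).Nonempty) :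
    IsOpen (Subtype.val ⁻¹' fatouInfty 𝓕 Set.univ :
        Set ↥(fatouLike 𝓕 Set.univ)) ∧
      IsClosed (Subtype.val ⁻¹' fatouInfty 𝓕 Set.univ :
        Set ↥(fatouLike 𝓕 Set.univ)) := by
  refine ⟨isOpen_iff_mem_nhds.2 fun z hz => ?_,
    isOpen_compl_iff.1 (isOpen_iff_mem_nhds.2 fun z hz => ?_)⟩ <;>
    obtain ⟨U, hU, hzU, h⟩ := exists_isOpen_subset_fatouInfty z.2
  · filter_upwards [(hU.preimage continuous_subtype_val).mem_nhds hzU] with w hw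
    exact h z hzU hz hw
  · filter_upwards [(hU.preimage continuous_subtype_val).mem_nhds hzU] with w hw hw'
    exact hz (h w hw hw' hzU)
end

section
/- For α ∈ ℂ, let 𝓕_α = {z ↦ n(z − α) : n ∈ ℕ, n ≥ 1} and let 𝓕 = ⋃_{|α| ≤ 1} 𝓕_α, a family of entire functions. Then J(𝓕) = {z ∈ ℂ : |z| ≤ 1}; in particular J(𝓕) has nonempty interior and J(𝓕) ≠ ℂ. -/
open Filter Topology

/-- A jointly continuous function, evaluated along a convergent sequence of parameters, converges
locally uniformly in the remaining variable. -/
theorem Continuous.tendstoLocallyUniformlyOn_of_tendsto {ι P X Y : Type*} [TopologicalSpace P]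
    [TopologicalSpace X] [UniformSpace Y] {H : P → X → Y} (hH : Continuous (Function.uncurry H))
    {l : Filter ι} {p : ι → P} {a : P} (hp : Tendsto p l (𝓝 a)) (s : Set X) :
    TendstoLocallyUniformlyOn (fun i => H (p i)) (H a) l s := by
  rw [tendstoLocallyUniformlyOn_iff_forall_tendsto]
  intro x _
  have hx : Tendsto (fun y : ι × X => y.2) (l ×ˢ 𝓝[s] x) (𝓝 x) :=
    tendsto_snd.mono_right nhdsWithin_le_nhds
  have h₁ : Tendsto (fun y : ι × X => H a y.2) (l ×ˢ 𝓝[s] x) (𝓝 (H a x)) :=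
    (hH.tendsto (a, x)).comp (tendsto_const_nhds.prodMk_nhds hx)
  have h₂ : Tendsto (fun y : ι × X => H (p y.1) y.2) (l ×ˢ 𝓝[s] x) (𝓝 (H a x)) :=
    (hH.tendsto (a, x)).comp ((hp.comp tendsto_fst).prodMk_nhds hx)
  exact (h₁.prodMk_nhds h₂).mono_right (nhds_le_uniformity _)

/-- A family containing all the maps `z ↦ n (z - z₀)`, `n ≥ 1`, is not normal at `z₀`. -/
theorem not_isNormalAt_of_mul_sub_mem {𝓕 : Set (ℂ → ℂ)} {D : Set ℂ} {z₀ : ℂ}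
    (h : ∀ n : ℕ, 1 ≤ n → (fun z => (n : ℂ) * (z - z₀)) ∈ 𝓕) : ¬ IsNormalAt 𝓕 D z₀ := by
  rintro ⟨U, hU, hz₀, -, hseq⟩
  obtain ⟨φ, hφ, ⟨g, -, hg⟩ | hinf⟩ :=
    hseq (fun n z => ((n + 1 : ℕ) : ℂ) * (z - z₀)) fun n => h (n + 1) (by omega)
  · obtain ⟨ε, hε, hball⟩ := Metric.isOpen_iff.1 hU z₀ hz₀
    obtain ⟨w, hw, hne⟩ : ∃ w ∈ U, w - z₀ ≠ 0 := by
      have hε' : ((ε / 2 : ℝ) : ℂ) ≠ 0 := by exact_mod_cast (half_pos hε).ne'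
      refine ⟨z₀ + ((ε / 2 : ℝ) : ℂ), hball ?_, by simpa using hε'⟩
      rw [Metric.mem_ball, dist_eq_norm, add_sub_cancel_left, Complex.norm_real,
        Real.norm_of_nonneg (half_pos hε).le]
      exact half_lt_self hε
    have hlim := (hg.tendsto_at hw).norm
    have htop : Tendsto (fun n => ‖((φ n + 1 : ℕ) : ℂ) * (w - z₀)‖) atTop atTop := by
      simp only [norm_mul, Complex.norm_natCast]
      exact (tendsto_natCast_atTop_atTop.comp
        ((tendsto_add_atTop_nat 1).comp hφ.tendsto_atTop)).atTop_mul_const (norm_pos_iff.2 hne)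
    exact not_tendsto_nhds_of_tendsto_atTop htop _ hlim
  · obtain ⟨n, hn⟩ := (hinf 1 {z₀} (by simpa using hz₀) isCompact_singleton).exists
    have := hn z₀ rfl
    norm_num at this

/-- A family of maps `z ↦ n (z - α)` with `‖α‖ ≤ 1` is normal at every point outside the closed
unit disk. -/
theorem isNormalAt_of_one_lt_norm {𝓕 : Set (ℂ → ℂ)} {z₀ : ℂ}
    (h : ∀ f ∈ 𝓕, ∃ n : ℕ, 1 ≤ n ∧ ∃ α : ℂ, ‖α‖ ≤ 1 ∧ f = fun z => (n : ℂ) * (z - α))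
    (hz₀ : 1 < ‖z₀‖) : IsNormalAt 𝓕 Set.univ z₀ := by
  obtain ⟨r, hr, hrz⟩ := exists_between hz₀
  refine ⟨{z | r < ‖z‖}, isOpen_lt continuous_const continuous_norm, hrz, Set.subset_univ _,
    fun f hf => ?_⟩
  choose n _ α hα hfn using fun k => h (f k) (hf k)
  by_cases hn : ∀ N : ℕ, ∃ᶠ k in atTop, N ≤ n k
  · obtain ⟨φ, hφ, hNφ⟩ := extraction_forall_of_frequently hn
    refine ⟨φ, hφ, Or.inr fun M K hK _ => ?_⟩
    have htop : Tendsto (fun k : ℕ => (k : ℝ) * (r - 1)) atTop atTop :=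
      tendsto_natCast_atTop_atTop.atTop_mul_const (sub_pos.2 hr)
    filter_upwards [htop.eventually_ge_atTop M] with k hk z hz
    have hzr : r < ‖z‖ := hK hz
    have hsub : r - 1 ≤ ‖z - α (φ k)‖ := by
      linarith [norm_sub_norm_le z (α (φ k)), hα (φ k)]
    rw [hfn, norm_mul, Complex.norm_natCast]
    exact hk.trans (mul_le_mul (by exact_mod_cast hNφ k) hsub (by linarith) (Nat.cast_nonneg _))
  · push Not at hn
    obtain ⟨N, hN⟩ := hn
    have hbdd : ∀ᶠ k in atTop, ((n k : ℂ), α k) ∈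
        Metric.closedBall (0 : ℂ) N ×ˢ Metric.closedBall (0 : ℂ) 1 := by
      filter_upwards [hN] with k hk
      simpa [hα k] using hk.le
    obtain ⟨a, -, φ, hφ, ha⟩ := tendsto_subseq_of_frequently_bounded
      (Metric.isBounded_closedBall.prod Metric.isBounded_closedBall) hbdd.frequently
    refine ⟨φ, hφ, Or.inl ⟨fun z => a.1 * (z - a.2), by fun_prop, ?_⟩⟩
    simp only [hfn]
    exact Continuous.tendstoLocallyUniformlyOn_of_tendsto
      (H := fun (p : ℂ × ℂ) (z : ℂ) => p.1 * (z - p.2)) (by fun_prop) ha _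

/-- For `𝓕 = ⋃_{|α| ≤ 1} {z ↦ n(z - α) : n ≥ 1}`, the Julia like
set is the closed unit disk; in particular it has nonempty interior and is not
all of `ℂ`. -/
theorem juliaLike_closedBall :
    juliaLike {f : ℂ → ℂ | ∃ n : ℕ, 1 ≤ n ∧ ∃ α : ℂ, ‖α‖ ≤ 1 ∧
        f = fun z => (n : ℂ) * (z - α)} Set.univ = Metric.closedBall 0 1 ∧
      (interior (juliaLike {f : ℂ → ℂ | ∃ n : ℕ, 1 ≤ n ∧ ∃ α : ℂ, ‖α‖ ≤ 1 ∧
        f = fun z => (n : ℂ) * (z - α)} Set.univ)).Nonempty ∧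
      juliaLike {f : ℂ → ℂ | ∃ n : ℕ, 1 ≤ n ∧ ∃ α : ℂ, ‖α‖ ≤ 1 ∧
        f = fun z => (n : ℂ) * (z - α)} Set.univ ≠ Set.univ := by
  have hJ : juliaLike {f : ℂ → ℂ | ∃ n : ℕ, 1 ≤ n ∧ ∃ α : ℂ, ‖α‖ ≤ 1 ∧
      f = fun z => (n : ℂ) * (z - α)} Set.univ = Metric.closedBall 0 1 := by
    ext z
    rw [mem_closedBall_zero_iff]
    constructor
    · intro hz
      by_contra! hlt
      exact hz.2 ⟨Set.mem_univ z, isNormalAt_of_one_lt_norm (fun _ hf => hf) hlt⟩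
    · intro hz
      refine ⟨Set.mem_univ z, fun hF => not_isNormalAt_of_mul_sub_mem ?_ hF.2⟩
      exact fun n hn => ⟨n, hn, z, hz, rfl⟩
  rw [hJ]
  refine ⟨rfl, ?_, fun h => ?_⟩
  · exact (Metric.nonempty_ball.2 one_pos).mono Metric.ball_subset_interior_closedBall
  · have h2 : (2 : ℂ) ∈ Metric.closedBall (0 : ℂ) 1 := h ▸ Set.mem_univ _
    norm_num at h2
end

section
/- Let 𝓕₁ = {z ↦ nz : n ∈ ℕ, n ≥ 1} and 𝓕₂ = {z ↦ zⁿ : n ∈ ℕ, n ≥ 1}, both viewed as families of entire functions. Then J(𝓕₁ ∪ 𝓕₂) = {z ∈ ℂ : |z| = 1} ∪ {0}; moreover F(𝓕₁ ∪ 𝓕₂) is not forward invariant under 𝓕₁ ∪ 𝓕₂, and J(𝓕₁ ∪ 𝓕₂) is not a perfect set (0 is an isolated point of it). -/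
open Filter Topology

/-- Every sequence in `𝓕` has a subsequence converging locally uniformly on `U`, either to a
holomorphic function or to `∞`. -/
def IsNormalFamilyOn (𝓕 : Set (ℂ → ℂ)) (U : Set ℂ) : Prop :=
  ∀ f : ℕ → ℂ → ℂ, (∀ n, f n ∈ 𝓕) →
    ∃ φ : ℕ → ℕ, StrictMono φ ∧
      ((∃ g : ℂ → ℂ, DifferentiableOn ℂ g U ∧
          TendstoLocallyUniformlyOn (fun n => f (φ n)) g atTop U) ∨
        TendstoInftyLocallyUniformlyOn (fun n => f (φ n)) U)

theorem IsNormalFamilyOn.union {𝓕 𝓖 : Set (ℂ → ℂ)} {U : Set ℂ}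
    (hF : IsNormalFamilyOn 𝓕 U) (hG : IsNormalFamilyOn 𝓖 U) : IsNormalFamilyOn (𝓕 ∪ 𝓖) U := by
  intro f hf
  have hfreq : (∃ᶠ n in atTop, f n ∈ 𝓕) ∨ ∃ᶠ n in atTop, f n ∈ 𝓖 :=
    frequently_or_distrib.1 (Frequently.of_forall hf)
  rcases hfreq with h | h
  · obtain ⟨φ, hφ, hmem⟩ := extraction_of_frequently_atTop h
    obtain ⟨ψ, hψ, hlim⟩ := hF (fun n => f (φ n)) hmem
    exact ⟨φ ∘ ψ, hφ.comp hψ, hlim⟩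
  · obtain ⟨φ, hφ, hmem⟩ := extraction_of_frequently_atTop h
    obtain ⟨ψ, hψ, hlim⟩ := hG (fun n => f (φ n)) hmem
    exact ⟨φ ∘ ψ, hφ.comp hψ, hlim⟩

/-- A sequence of natural numbers either has a constant subsequence or tends to infinity. -/
theorem exists_constant_subseq_or_tendsto_atTop (k : ℕ → ℕ) :
    (∃ c, ∃ φ : ℕ → ℕ, StrictMono φ ∧ ∀ n, k (φ n) = c) ∨ Tendsto k atTop atTop := by
  by_cases h : ∃ c, ∃ᶠ n in atTop, k n = c
  · obtain ⟨c, hc⟩ := h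
    exact Or.inl ⟨c, extraction_of_frequently_atTop hc⟩
  · right
    push Not at h
    refine tendsto_atTop.2 fun b => ?_
    have hall : ∀ᶠ n in atTop, ∀ c ∈ Finset.range b, k n ≠ c :=
      (eventually_all_finset _).2 fun c _ => h c
    filter_upwards [hall] with n hn
    by_contra! hlt
    exact hn _ (Finset.mem_range.2 hlt) rfl

/-- The terms of a sequence of holomorphic functions converging locally uniformly to a
holomorphic function or to `∞` form a normal family. -/
theorem isNormalFamilyOn_range {g : ℕ → ℂ → ℂ} {U : Set ℂ}
    (hd : ∀ n, DifferentiableOn ℂ (g n) U)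
    (hlim : (∃ h : ℂ → ℂ, DifferentiableOn ℂ h U ∧ TendstoLocallyUniformlyOn g h atTop U) ∨
      TendstoInftyLocallyUniformlyOn g U) :
    IsNormalFamilyOn (Set.range g) U := by
  intro f hf
  choose k hk using hf
  obtain rfl : (fun n => g (k n)) = f := funext hk
  rcases exists_constant_subseq_or_tendsto_atTop k with ⟨c, φ, hφ, hc⟩ | htop
  · refine ⟨φ, hφ, Or.inl ⟨g c, hd c, ?_⟩⟩
    simp only [hc]
    exact fun u hu x _ =>
      ⟨Set.univ, univ_mem, Eventually.of_forall fun _ _ _ => refl_mem_uniformity hu⟩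
  · refine ⟨id, strictMono_id, ?_⟩
    rcases hlim with ⟨h, hh, ht⟩ | ht
    · refine Or.inl ⟨h, hh, fun u hu x hx => ?_⟩
      obtain ⟨t, ht, hev⟩ := ht u hu x hx
      exact ⟨t, ht, htop.eventually hev⟩
    · exact Or.inr fun M K hKU hK => htop.eventually (ht M K hKU hK)

theorem IsNormalFamilyOn.mono {𝓕 𝓖 : Set (ℂ → ℂ)} {U : Set ℂ} (hG : IsNormalFamilyOn 𝓖 U)
    (h : 𝓕 ⊆ 𝓖) : IsNormalFamilyOn 𝓕 U :=
  fun f hf => hG f fun n => h (hf n)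

/-- A family is not normal at a point where one of its sequences stays bounded, if this sequence
tends to `∞` at points arbitrarily close to it. -/
theorem not_isNormalAt_of_bounded_of_frequently {𝓕 : Set (ℂ → ℂ)} {D : Set ℂ} {z₀ : ℂ}
    {f : ℕ → ℂ → ℂ} (hf : ∀ n, f n ∈ 𝓕) {C : ℝ} (hC : ∀ n, ‖f n z₀‖ ≤ C)
    (hinf : ∃ᶠ z in 𝓝 z₀, Tendsto (fun n => ‖f n z‖) atTop atTop) :
    ¬ IsNormalAt 𝓕 D z₀ := by
  rintro ⟨U, hU, hz₀, -, hN⟩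
  obtain ⟨φ, hφ, ⟨g, -, hg⟩ | hI⟩ := hN f hf
  · obtain ⟨b, hb, hbU⟩ := (hinf.and_eventually (hU.mem_nhds hz₀)).exists
    exact not_tendsto_nhds_of_tendsto_atTop (hb.comp hφ.tendsto_atTop) _
      (hg.tendsto_at hbU).norm
  · obtain ⟨n, hn⟩ := (hI (C + 1) {z₀} (by simpa using hz₀) isCompact_singleton).exists
    linarith [hn z₀ rfl, hC (φ n)]

theorem tendstoInftyLocallyUniformlyOn_natCast_mul {U : Set ℂ} (hU : (0 : ℂ) ∉ U) :
    TendstoInftyLocallyUniformlyOn (fun n z => (n : ℂ) * z) U := by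
  intro M K hKU hK
  rcases K.eq_empty_or_nonempty with rfl | hne
  · simp
  obtain ⟨x, hxK, hx⟩ := hK.exists_isMinOn hne continuous_norm.continuousOn
  have hpos : 0 < ‖x‖ := norm_pos_iff.2 fun h => hU (h ▸ hKU hxK)
  filter_upwards [(tendsto_natCast_atTop_atTop.atTop_mul_const hpos).eventually_ge_atTop M]
    with n hn z hz
  rw [norm_mul, Complex.norm_natCast]
  exact hn.trans (mul_le_mul_of_nonneg_left (hx hz) n.cast_nonneg)

theorem tendstoInftyLocallyUniformlyOn_pow {U : Set ℂ} (hU : ∀ z ∈ U, 1 < ‖z‖) :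
    TendstoInftyLocallyUniformlyOn (fun n z => z ^ n) U := by
  intro M K hKU hK
  rcases K.eq_empty_or_nonempty with rfl | hne
  · simp
  obtain ⟨x, hxK, hx⟩ := hK.exists_isMinOn hne continuous_norm.continuousOn
  filter_upwards [(tendsto_pow_atTop_atTop_of_one_lt (hU x (hKU hxK))).eventually_ge_atTop M]
    with n hn z hz
  rw [norm_pow]
  exact hn.trans (pow_le_pow_left₀ (norm_nonneg x) (hx hz) n)

theorem tendstoLocallyUniformlyOn_pow_zero {U : Set ℂ} (hU : ∀ z ∈ U, ‖z‖ < 1) :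
    TendstoLocallyUniformlyOn (fun n (z : ℂ) => z ^ n) (fun _ => 0) atTop U := by
  rw [Metric.tendstoLocallyUniformlyOn_iff]
  intro ε hε x hx
  obtain ⟨r, hxr, hr⟩ := exists_between (hU x hx)
  refine ⟨{z | ‖z‖ < r}, mem_nhdsWithin_of_mem_nhds
    ((isOpen_lt continuous_norm continuous_const).mem_nhds hxr), ?_⟩
  filter_upwards [(tendsto_pow_atTop_nhds_zero_of_lt_one
    ((norm_nonneg x).trans hxr.le) hr).eventually_lt_const hε] with n hn z hz
  rw [dist_zero_left, norm_pow]
  exact (pow_le_pow_left₀ (norm_nonneg z) (le_of_lt hz) n).trans_lt hn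

/-- The family of the functions `z ↦ nz` and `z ↦ zⁿ`, `n ≥ 1`. -/
abbrev mulPowFamily : Set (ℂ → ℂ) :=
  {f : ℂ → ℂ | ∃ n : ℕ, 1 ≤ n ∧ f = fun z => (n : ℂ) * z} ∪
    {f : ℂ → ℂ | ∃ n : ℕ, 1 ≤ n ∧ f = fun z => z ^ n}

theorem isNormalFamilyOn_mulPowFamily {U : Set ℂ} (h0 : (0 : ℂ) ∉ U)
    (h1 : (∀ z ∈ U, ‖z‖ < 1) ∨ ∀ z ∈ U, 1 < ‖z‖) : IsNormalFamilyOn mulPowFamily U := by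
  refine IsNormalFamilyOn.union
    ((isNormalFamilyOn_range (g := fun n z => (n : ℂ) * z) (fun n => by fun_prop)
      (Or.inr (tendstoInftyLocallyUniformlyOn_natCast_mul h0))).mono ?_)
    ((isNormalFamilyOn_range (g := fun n z => z ^ n) (fun n => by fun_prop) ?_).mono ?_)
  · rintro _ ⟨n, -, rfl⟩
    exact ⟨n, rfl⟩
  · exact h1.imp (fun h => ⟨fun _ => 0, by fun_prop, tendstoLocallyUniformlyOn_pow_zero h⟩)
      tendstoInftyLocallyUniformlyOn_pow
  · rintro _ ⟨n, -, rfl⟩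
    exact ⟨n, rfl⟩

theorem isNormalAt_mulPowFamily {z : ℂ} (h0 : z ≠ 0) (h1 : ‖z‖ ≠ 1) :
    IsNormalAt mulPowFamily Set.univ z := by
  rcases h1.lt_or_gt with h | h
  · exact ⟨Metric.ball 0 1 \ {0}, Metric.isOpen_ball.sdiff isClosed_singleton, by simp [h, h0],
      Set.subset_univ _, isNormalFamilyOn_mulPowFamily (by simp) (Or.inl (by simp +contextual))⟩
  · exact ⟨{w | 1 < ‖w‖}, isOpen_lt continuous_const continuous_norm, h, Set.subset_univ _,
      isNormalFamilyOn_mulPowFamily (by simp) (Or.inr fun _ hw => hw)⟩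

theorem not_isNormalAt_mulPowFamily_zero : ¬ IsNormalAt mulPowFamily Set.univ 0 := by
  refine not_isNormalAt_of_bounded_of_frequently (f := fun n z => ((n + 1 : ℕ) : ℂ) * z) (C := 0)
    (fun n => Or.inl ⟨n + 1, by simp, rfl⟩) (by simp) ?_
  have hne : ∃ᶠ z : ℂ in 𝓝 0, z ≠ 0 :=
    frequently_iff_neBot.2 (inferInstanceAs (𝓝[≠] (0 : ℂ)).NeBot)
  refine hne.mono fun z hz => ?_
  simp only [norm_mul, Complex.norm_natCast]
  exact ((tendsto_natCast_atTop_atTop.comp (tendsto_add_atTop_nat 1)).atTop_mul_const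
    (norm_pos_iff.2 hz))

theorem not_isNormalAt_mulPowFamily_of_norm_eq_one {z : ℂ} (hz : ‖z‖ = 1) :
    ¬ IsNormalAt mulPowFamily Set.univ z := by
  refine not_isNormalAt_of_bounded_of_frequently (f := fun n z => z ^ (n + 1)) (C := 1)
    (fun n => Or.inr ⟨n + 1, by simp, rfl⟩) (by simp [hz]) ?_
  have ht : Tendsto (fun t : ℝ => (t : ℂ) * z) (𝓝[>] 1) (𝓝 z) := by
    have hc : Continuous fun t : ℝ => (t : ℂ) * z := by fun_prop
    simpa using (hc.tendsto 1).mono_left nhdsWithin_le_nhds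
  refine ht.frequently (Eventually.frequently ?_)
  filter_upwards [self_mem_nhdsWithin] with t (h1 : 1 < t)
  have hnorm : ‖(t : ℂ) * z‖ = t := by
    rw [norm_mul, hz, mul_one, Complex.norm_real, Real.norm_of_nonneg (by linarith)]
  simp only [norm_pow, hnorm]
  exact (tendsto_pow_atTop_atTop_of_one_lt h1).comp (tendsto_add_atTop_nat 1)

theorem juliaLike_mulPowFamily :
    juliaLike mulPowFamily Set.univ = Metric.sphere 0 1 ∪ {0} := by
  ext z
  simp only [juliaLike, fatouLike, Set.mem_sdiff, Set.mem_univ, true_and, Set.mem_ofPred_eq,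
    Set.mem_union, mem_sphere_zero_iff_norm, Set.mem_singleton_iff]
  constructor
  · intro h
    by_contra! hz
    exact h (isNormalAt_mulPowFamily hz.2 hz.1)
  · rintro (h | rfl)
    · exact not_isNormalAt_mulPowFamily_of_norm_eq_one h
    · exact not_isNormalAt_mulPowFamily_zero

/-- For `𝓕₁ = {z ↦ nz : n ≥ 1}` and `𝓕₂ = {z ↦ zⁿ : n ≥ 1}`,
`J(𝓕₁ ∪ 𝓕₂) = {|z| = 1} ∪ {0}`; moreover `F(𝓕₁ ∪ 𝓕₂)` is not forward invariant
under `𝓕₁ ∪ 𝓕₂`, and `J(𝓕₁ ∪ 𝓕₂)` is not perfect: `0` is an isolated point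
of it. -/
theorem juliaLike_union_sphere_zero :
    juliaLike ({f : ℂ → ℂ | ∃ n : ℕ, 1 ≤ n ∧ f = fun z => (n : ℂ) * z} ∪
        {f : ℂ → ℂ | ∃ n : ℕ, 1 ≤ n ∧ f = fun z => z ^ n}) Set.univ =
      Metric.sphere 0 1 ∪ {0} ∧
    ¬ (∀ f ∈ ({f : ℂ → ℂ | ∃ n : ℕ, 1 ≤ n ∧ f = fun z => (n : ℂ) * z} ∪
        {f : ℂ → ℂ | ∃ n : ℕ, 1 ≤ n ∧ f = fun z => z ^ n}),
      f '' fatouLike ({f : ℂ → ℂ | ∃ n : ℕ, 1 ≤ n ∧ f = fun z => (n : ℂ) * z} ∪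
          {f : ℂ → ℂ | ∃ n : ℕ, 1 ≤ n ∧ f = fun z => z ^ n}) Set.univ ⊆
        fatouLike ({f : ℂ → ℂ | ∃ n : ℕ, 1 ≤ n ∧ f = fun z => (n : ℂ) * z} ∪
          {f : ℂ → ℂ | ∃ n : ℕ, 1 ≤ n ∧ f = fun z => z ^ n}) Set.univ) ∧
    (0 : ℂ) ∈ juliaLike ({f : ℂ → ℂ | ∃ n : ℕ, 1 ≤ n ∧ f = fun z => (n : ℂ) * z} ∪
        {f : ℂ → ℂ | ∃ n : ℕ, 1 ≤ n ∧ f = fun z => z ^ n}) Set.univ ∧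
    ¬ AccPt (0 : ℂ) (𝓟 (juliaLike
        ({f : ℂ → ℂ | ∃ n : ℕ, 1 ≤ n ∧ f = fun z => (n : ℂ) * z} ∪
          {f : ℂ → ℂ | ∃ n : ℕ, 1 ≤ n ∧ f = fun z => z ^ n}) Set.univ)) := by
  change juliaLike mulPowFamily Set.univ = _ ∧
    ¬ (∀ f ∈ mulPowFamily, f '' fatouLike mulPowFamily Set.univ ⊆ fatouLike mulPowFamily Set.univ) ∧
    (0 : ℂ) ∈ juliaLike mulPowFamily Set.univ ∧
    ¬ AccPt (0 : ℂ) (𝓟 (juliaLike mulPowFamily Set.univ))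
  refine ⟨juliaLike_mulPowFamily, fun h => ?_, by simp [juliaLike_mulPowFamily], ?_⟩
  · have hhalf : (1 / 2 : ℂ) ∈ fatouLike mulPowFamily Set.univ :=
      ⟨Set.mem_univ _, isNormalAt_mulPowFamily (by norm_num) (by norm_num)⟩
    have hone := h (fun z => ((2 : ℕ) : ℂ) * z) (Or.inl ⟨2, by norm_num, rfl⟩)
      (Set.mem_image_of_mem _ hhalf)
    exact not_isNormalAt_mulPowFamily_of_norm_eq_one (by norm_num) hone.2
  · rw [juliaLike_mulPowFamily, accPt_iff_frequently]
    intro h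
    obtain ⟨z, ⟨hz0, hz⟩, hball⟩ :=
      (h.and_eventually (Metric.ball_mem_nhds (0 : ℂ) one_pos)).exists
    rcases hz with hz | hz
    · exact (Metric.mem_ball.1 hball).ne (Metric.mem_sphere.1 hz)
    · exact hz0 hz
end

section
/- Let 𝓕 = {z ↦ nz : n ∈ ℕ, n ≥ 1} ∪ {z ↦ n(z − 1) : n ∈ ℕ, n ≥ 1} and 𝓖 = {z ↦ n(z − 1) : n ∈ ℕ, n ≥ 1} ∪ {z ↦ e^{nz} : n ∈ ℕ, n ≥ 1}, both families of entire functions. Then J(𝓕 ∩ 𝓖) = {1} while J(𝓕) ∩ J(𝓖) = {0, 1}; in particular the inclusion J(𝓕 ∩ 𝓖) ⊆ J(𝓕) ∩ J(𝓖) can be strict. -/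
open Filter Topology

theorem TendstoInftyLocallyUniformlyOn.mono {F : ℕ → ℂ → ℂ} {U V : Set ℂ}
    (h : TendstoInftyLocallyUniformlyOn F U) (hVU : V ⊆ U) :
    TendstoInftyLocallyUniformlyOn F V :=
  fun M K hK hKc => h M K (hK.trans hVU) hKc

theorem IsNormalAt.anti {𝓕 𝓖 : Set (ℂ → ℂ)} {D : Set ℂ} {z₀ : ℂ} (h : IsNormalAt 𝓖 D z₀)
    (hsub : 𝓕 ⊆ 𝓖) : IsNormalAt 𝓕 D z₀ := by
  obtain ⟨U, hU, hz, hUD, H⟩ := h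
  exact ⟨U, hU, hz, hUD, fun f hf => H f fun n => hsub (hf n)⟩

theorem juliaLike_mono {𝓕 𝓖 : Set (ℂ → ℂ)} {D : Set ℂ} (hsub : 𝓕 ⊆ 𝓖) :
    juliaLike 𝓕 D ⊆ juliaLike 𝓖 D :=
  fun _ hz => ⟨hz.1, fun h => hz.2 ⟨h.1, h.2.anti hsub⟩⟩

theorem IsNormalAt.union {𝓕 𝓖 : Set (ℂ → ℂ)} {D : Set ℂ} {z₀ : ℂ} (h𝓕 : IsNormalAt 𝓕 D z₀)
    (h𝓖 : IsNormalAt 𝓖 D z₀) : IsNormalAt (𝓕 ∪ 𝓖) D z₀ := by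
  obtain ⟨U, hU, hzU, hUD, HU⟩ := h𝓕
  obtain ⟨V, hV, hzV, -, HV⟩ := h𝓖
  refine ⟨U ∩ V, hU.inter hV, ⟨hzU, hzV⟩, Set.inter_subset_left.trans hUD, fun f hf => ?_⟩
  have key : ∀ (𝓗 : Set (ℂ → ℂ)) (W : Set ℂ), U ∩ V ⊆ W → (∃ᶠ n in atTop, f n ∈ 𝓗) →
      (∀ f : ℕ → ℂ → ℂ, (∀ n, f n ∈ 𝓗) →
        ∃ φ : ℕ → ℕ, StrictMono φ ∧
          ((∃ g : ℂ → ℂ, DifferentiableOn ℂ g W ∧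
              TendstoLocallyUniformlyOn (fun n => f (φ n)) g atTop W) ∨
            TendstoInftyLocallyUniformlyOn (fun n => f (φ n)) W)) →
      ∃ φ : ℕ → ℕ, StrictMono φ ∧
        ((∃ g : ℂ → ℂ, DifferentiableOn ℂ g (U ∩ V) ∧
            TendstoLocallyUniformlyOn (fun n => f (φ n)) g atTop (U ∩ V)) ∨
          TendstoInftyLocallyUniformlyOn (fun n => f (φ n)) (U ∩ V)) := by
    intro 𝓗 W hW hfreq H
    obtain ⟨ψ, hψ, hψf⟩ := extraction_of_frequently_atTop hfreq
    obtain ⟨φ, hφ, h⟩ := H (fun n => f (ψ n)) hψf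
    refine ⟨ψ ∘ φ, hψ.comp hφ, h.imp ?_ fun h => h.mono hW⟩
    rintro ⟨g, hg, hlim⟩
    exact ⟨g, hg.mono hW, hlim.mono hW⟩
  have hfreq : ∃ᶠ n in atTop, f n ∈ 𝓕 ∨ f n ∈ 𝓖 := (Eventually.of_forall hf).frequently
  rcases frequently_or_distrib.1 hfreq with h | h
  · exact key 𝓕 U Set.inter_subset_left h HU
  · exact key 𝓖 V Set.inter_subset_right h HV

theorem exists_strictMono_const_or_tendsto_atTop (k : ℕ → ℕ) :
    ∃ φ : ℕ → ℕ, StrictMono φ ∧ ((∃ c, ∀ n, k (φ n) = c) ∨ Tendsto (k ∘ φ) atTop atTop) := by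
  by_cases h : Tendsto k atTop atTop
  · exact ⟨id, strictMono_id, Or.inr h⟩
  · obtain ⟨b, hb⟩ : ∃ b, ∃ᶠ n in atTop, k n < b := by
      simpa [tendsto_atTop, Filter.Frequently] using h
    obtain ⟨c, hc⟩ : ∃ c, ∃ᶠ n in atTop, k n = c := by
      by_contra! hcon
      have hall : ∀ᶠ n in atTop, ∀ c ∈ Set.Iio b, k n ≠ c :=
        (eventually_all_finite (Set.finite_Iio b)).2 fun c _ => hcon c
      exact hb (hall.mono fun n hn hlt => hn _ hlt rfl)
    obtain ⟨φ, hφ, hφc⟩ := extraction_of_frequently_atTop hc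
    exact ⟨φ, hφ, Or.inl ⟨c, hφc⟩⟩

theorem isNormalAt_natCast_mul_sub {a z₀ : ℂ} (h : z₀ ≠ a) :
    IsNormalAt {f : ℂ → ℂ | ∃ n : ℕ, 1 ≤ n ∧ f = fun z => (n : ℂ) * (z - a)} Set.univ z₀ := by
  refine ⟨{a}ᶜ, isOpen_compl_singleton, h, Set.subset_univ _, fun f hf => ?_⟩
  choose k hk hfk using hf
  obtain ⟨φ, hφ, ⟨c, hc⟩ | hlim⟩ := exists_strictMono_const_or_tendsto_atTop k
  · refine ⟨φ, hφ, Or.inl ⟨fun z => (c : ℂ) * (z - a), by fun_prop, ?_⟩⟩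
    intro u hu x _
    refine ⟨Set.univ, univ_mem, Eventually.of_forall fun n y _ => ?_⟩
    simpa [hfk, hc] using refl_mem_uniformity hu
  · refine ⟨φ, hφ, Or.inr fun M K hKU hK => ?_⟩
    rcases K.eq_empty_or_nonempty with rfl | hne
    · simp
    obtain ⟨w, hwK, hw⟩ := hK.exists_isMinOn hne
      (f := fun z : ℂ => ‖z - a‖) (by fun_prop)
    have hpos : 0 < ‖w - a‖ := norm_pos_iff.2 (sub_ne_zero.2 (hKU hwK))
    have htend : Tendsto (fun n => ((k (φ n) : ℕ) : ℝ) * ‖w - a‖) atTop atTop :=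
      (tendsto_natCast_atTop_atTop.comp hlim).atTop_mul_const hpos
    filter_upwards [htend.eventually_ge_atTop M] with n hn z hz
    have hz' : ‖w - a‖ ≤ ‖z - a‖ := hw hz
    calc M ≤ (k (φ n) : ℝ) * ‖w - a‖ := hn
      _ ≤ (k (φ n) : ℝ) * ‖z - a‖ := by gcongr
      _ = ‖f (φ n) z‖ := by simp [hfk]

/-- A family containing a sequence that is bounded at `a` but blows up at all points
immediately to the right of `a` is not normal at `a`. -/
theorem mem_juliaLike_univ_of_tendsto {𝓕 : Set (ℂ → ℂ)} {a : ℂ} {f : ℕ → ℂ → ℂ}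
    (hf : ∀ n, f n ∈ 𝓕) {C : ℝ} (hC : ∀ n, ‖f n a‖ ≤ C)
    (hlim : ∀ t : ℝ, 0 < t → Tendsto (fun n => ‖f n (a + t)‖) atTop atTop) :
    a ∈ juliaLike 𝓕 Set.univ := by
  refine ⟨Set.mem_univ a, fun ⟨_, U, hU, haU, _, H⟩ => ?_⟩
  obtain ⟨φ, hφ, ⟨g, -, hg⟩ | h⟩ := H f hf
  · have hcont : Tendsto (fun t : ℝ => a + (t : ℂ)) (𝓝[>] 0) (𝓝 a) := by
      have : Continuous fun t : ℝ => a + (t : ℂ) := by fun_prop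
      simpa using (this.tendsto 0).mono_left nhdsWithin_le_nhds
    obtain ⟨t, htU, ht⟩ :=
      ((hcont.eventually (hU.mem_nhds haU)).and self_mem_nhdsWithin).exists
    exact not_tendsto_nhds_of_tendsto_atTop ((hlim t ht).comp hφ.tendsto_atTop) _
      (hg.tendsto_at htU).norm
  · obtain ⟨n, hn⟩ := (h (C + 1) {a} (by simpa using haU) isCompact_singleton).exists
    linarith [hn a rfl, hC (φ n)]

theorem mem_juliaLike_natCast_mul_sub (a : ℂ) :
    a ∈ juliaLike {f : ℂ → ℂ | ∃ n : ℕ, 1 ≤ n ∧ f = fun z => (n : ℂ) * (z - a)} Set.univ := by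
  refine mem_juliaLike_univ_of_tendsto (f := fun n z => ((n + 1 : ℕ) : ℂ) * (z - a)) (C := 0)
    (fun n => ⟨n + 1, by omega, rfl⟩) (by simp) fun t ht => ?_
  have := ((tendsto_natCast_atTop_atTop (R := ℝ)).comp (tendsto_add_atTop_nat 1)).atTop_mul_const ht
  refine this.congr fun n => ?_
  rw [add_sub_cancel_left, norm_mul, Complex.norm_natCast, Complex.norm_of_nonneg ht.le]
  rfl

theorem zero_mem_juliaLike_exp_natCast_mul :
    0 ∈ juliaLike {f : ℂ → ℂ | ∃ n : ℕ, 1 ≤ n ∧ f = fun z => Complex.exp ((n : ℂ) * z)}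
      Set.univ := by
  refine mem_juliaLike_univ_of_tendsto (f := fun n z => Complex.exp (((n + 1 : ℕ) : ℂ) * z))
    (C := 1) (fun n => ⟨n + 1, by omega, rfl⟩) (by simp) fun t ht => ?_
  have := ((tendsto_natCast_atTop_atTop (R := ℝ)).comp (tendsto_add_atTop_nat 1)).atTop_mul_const ht
  refine (Real.tendsto_exp_atTop.comp this).congr fun n => ?_
  simp [Complex.norm_exp]

theorem juliaLike_natCast_mul_sub (a : ℂ) :
    juliaLike {f : ℂ → ℂ | ∃ n : ℕ, 1 ≤ n ∧ f = fun z => (n : ℂ) * (z - a)} Set.univ = {a} := by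
  refine Set.Subset.antisymm (fun z hz => ?_)
    (Set.singleton_subset_iff.2 (mem_juliaLike_natCast_mul_sub a))
  by_contra hza
  exact hz.2 ⟨Set.mem_univ z, isNormalAt_natCast_mul_sub hza⟩

theorem juliaLike_union_univ (𝓕 𝓖 : Set (ℂ → ℂ)) :
    juliaLike (𝓕 ∪ 𝓖) Set.univ = juliaLike 𝓕 Set.univ ∪ juliaLike 𝓖 Set.univ := by
  refine Set.Subset.antisymm (fun z hz => ?_) (Set.union_subset
    (juliaLike_mono Set.subset_union_left) (juliaLike_mono Set.subset_union_right))
  by_contra hcon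
  simp only [juliaLike, fatouLike, Set.mem_union, Set.mem_sdiff, Set.mem_ofPred_eq, Set.mem_univ,
    true_and, not_or, not_not] at hcon hz
  exact hz (hcon.1.union hcon.2)

/-- For
`𝓕 = {z ↦ nz : n ≥ 1} ∪ {z ↦ n(z - 1) : n ≥ 1}` and
`𝓖 = {z ↦ n(z - 1) : n ≥ 1} ∪ {z ↦ e^{nz} : n ≥ 1}`,
one has `J(𝓕 ∩ 𝓖) = {1}` while `J(𝓕) ∩ J(𝓖) = {0, 1}`; in particular the
inclusion `J(𝓕 ∩ 𝓖) ⊆ J(𝓕) ∩ J(𝓖)` can be strict. -/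
theorem juliaLike_inter_strict :
    juliaLike (({f : ℂ → ℂ | ∃ n : ℕ, 1 ≤ n ∧ f = fun z => (n : ℂ) * z} ∪
          {f : ℂ → ℂ | ∃ n : ℕ, 1 ≤ n ∧ f = fun z => (n : ℂ) * (z - 1)}) ∩
        ({f : ℂ → ℂ | ∃ n : ℕ, 1 ≤ n ∧ f = fun z => (n : ℂ) * (z - 1)} ∪
          {f : ℂ → ℂ | ∃ n : ℕ, 1 ≤ n ∧ f = fun z => Complex.exp ((n : ℂ) * z)}))
      Set.univ = {1} ∧
    juliaLike ({f : ℂ → ℂ | ∃ n : ℕ, 1 ≤ n ∧ f = fun z => (n : ℂ) * z} ∪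
        {f : ℂ → ℂ | ∃ n : ℕ, 1 ≤ n ∧ f = fun z => (n : ℂ) * (z - 1)}) Set.univ ∩
      juliaLike ({f : ℂ → ℂ | ∃ n : ℕ, 1 ≤ n ∧ f = fun z => (n : ℂ) * (z - 1)} ∪
        {f : ℂ → ℂ | ∃ n : ℕ, 1 ≤ n ∧ f = fun z => Complex.exp ((n : ℂ) * z)})
      Set.univ = {0, 1} := by
  have hlin : juliaLike {f : ℂ → ℂ | ∃ n : ℕ, 1 ≤ n ∧ f = fun z => (n : ℂ) * z} Set.univ = {0} := by
    simpa using juliaLike_natCast_mul_sub 0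
  constructor
  · rw [← juliaLike_natCast_mul_sub 1]
    congr 1
    rw [Set.union_comm, ← Set.union_inter_distrib_left, Set.union_eq_left]
    rintro f ⟨⟨n, -, hn⟩, m, -, hm⟩
    simpa using congrFun (hn.symm.trans hm) 0
  · rw [juliaLike_union_univ, juliaLike_union_univ, hlin, juliaLike_natCast_mul_sub]
    refine Set.inter_eq_left.2 ?_
    rintro z (rfl | rfl)
    · exact Or.inr zero_mem_juliaLike_exp_natCast_mul
    · exact Or.inl rfl
end
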